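/- arXiv:2305.05272 — 2 statements merged into one kernel-verified Lean document; each statement's English description precedes it below -/
import Mathlib

section
/- For any real numbers δ, δ' with 0 < δ' < δ < 1, there exists a constant C > 0 depending only on δ and δ' such that for every integer m ≥ 3 and every s > 0: s^{δ} |F_m(s)| + s^{1+δ} |F_m'(s)| + s^{2+δ} |F_m''(s)| ≤ C m^{−δ'}. -/
open Real MeasureTheory

noncomputable section

/-- `F_m(s) = ∫₀^π cos(mθ)/√(s + 2(1 − cos θ)) dθ`. -/
def Fm (m : ℕ) (s : ℝ) : ℝ :=
  ∫ θ in (0:ℝ)..Real.pi, Real.cos (m * θ) / Real.sqrt (s + 2 * (1 - Real.cos θ))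

/-- `F_m'(s) = −(1/2)∫₀^π cos(mθ)(s + 2(1 − cos θ))^{−3/2} dθ`. -/
def Fm' (m : ℕ) (s : ℝ) : ℝ :=
  -(1/2) * ∫ θ in (0:ℝ)..Real.pi, Real.cos (m * θ) * (s + 2 * (1 - Real.cos θ)) ^ (-(3:ℝ)/2)

/-- `F_m''(s) = (3/4)∫₀^π cos(mθ)(s + 2(1 − cos θ))^{−5/2} dθ`. -/
def Fm'' (m : ℕ) (s : ℝ) : ℝ :=
  (3/4) * ∫ θ in (0:ℝ)..Real.pi, Real.cos (m * θ) * (s + 2 * (1 - Real.cos θ)) ^ (-(5:ℝ)/2)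

/-- The common shape of the three integrals: `∫₀^π cos(mθ)(s + 2(1 − cos θ))^{-p} dθ`. -/
def cosKernelIntegral (m : ℕ) (p s : ℝ) : ℝ :=
  ∫ θ in (0:ℝ)..Real.pi, Real.cos (m * θ) * (s + 2 * (1 - Real.cos θ)) ^ (-p)

lemma le_kernel_base (s θ : ℝ) : s ≤ s + 2 * (1 - Real.cos θ) := by
  linarith [Real.cos_le_one θ]

lemma continuous_kernel_rpow {s : ℝ} (hs : 0 < s) (q : ℝ) :
    Continuous fun θ : ℝ => (s + 2 * (1 - Real.cos θ)) ^ q :=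
  Continuous.rpow_const (by fun_prop) fun θ => Or.inl (hs.trans_le (le_kernel_base s θ)).ne'

lemma hasDerivAt_kernel_rpow {s : ℝ} (hs : 0 < s) (p θ : ℝ) :
    HasDerivAt (fun θ : ℝ => (s + 2 * (1 - Real.cos θ)) ^ (-p))
      (-(2 * p * Real.sin θ * (s + 2 * (1 - Real.cos θ)) ^ (-p - 1))) θ := by
  have h : HasDerivAt (fun θ : ℝ => s + 2 * (1 - Real.cos θ)) (2 * Real.sin θ) θ := by
    simpa using (((Real.hasDerivAt_cos θ).const_sub 1).const_mul 2).const_add s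
  convert h.rpow_const (p := -p) (Or.inl (hs.trans_le (le_kernel_base s θ)).ne') using 1
  ring

lemma continuous_deriv_kernel_rpow {s : ℝ} (hs : 0 < s) (p : ℝ) :
    Continuous fun θ : ℝ => 2 * p * Real.sin θ * (s + 2 * (1 - Real.cos θ)) ^ (-p - 1) :=
  Continuous.mul (by fun_prop) (continuous_kernel_rpow hs _)

lemma integral_deriv_kernel_rpow {s : ℝ} (hs : 0 < s) (p : ℝ) :
    ∫ θ in (0:ℝ)..Real.pi, 2 * p * Real.sin θ * (s + 2 * (1 - Real.cos θ)) ^ (-p - 1)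
      = s ^ (-p) - (s + 4) ^ (-p) := by
  have h := intervalIntegral.integral_eq_sub_of_hasDerivAt
    (fun θ _ => hasDerivAt_kernel_rpow hs p θ)
    ((continuous_deriv_kernel_rpow hs p).neg.intervalIntegrable 0 Real.pi)
  rw [intervalIntegral.integral_neg] at h
  simp only [Real.cos_pi, Real.cos_zero] at h
  norm_num at h
  linarith

/-- Integration by parts gains a factor `1 / m`. -/
lemma abs_cosKernelIntegral_le_integral_deriv {m : ℕ} (hm : 0 < m) {p s : ℝ} (hp : 0 < p)
    (hs : 0 < s) :
    |cosKernelIntegral m p s| ≤ (1 / m) *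
      ∫ θ in (0:ℝ)..Real.pi, 2 * p * Real.sin θ * (s + 2 * (1 - Real.cos θ)) ^ (-p - 1) := by
  have hm' : (0:ℝ) < m := by exact_mod_cast hm
  have hv : ∀ θ : ℝ, HasDerivAt (fun θ : ℝ => Real.sin (m * θ) / m) (Real.cos (m * θ)) θ := by
    intro θ
    have h := (((hasDerivAt_id' θ).const_mul (m:ℝ)).sin).div_const (m:ℝ)
    rwa [mul_one, mul_div_cancel_right₀ _ hm'.ne'] at h
  have hparts := intervalIntegral.integral_mul_deriv_eq_deriv_mul (a := 0) (b := Real.pi)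
    (fun θ _ => hasDerivAt_kernel_rpow hs p θ) (fun θ _ => hv θ)
    ((continuous_deriv_kernel_rpow hs p).neg.intervalIntegrable 0 Real.pi)
    (Continuous.intervalIntegrable (by fun_prop) 0 Real.pi)
  have heq : cosKernelIntegral m p s = ∫ θ in (0:ℝ)..Real.pi,
      (2 * p * Real.sin θ * (s + 2 * (1 - Real.cos θ)) ^ (-p - 1)) *
        (Real.sin (m * θ) / m) := by
    simp only [Real.sin_nat_mul_pi, mul_zero, Real.sin_zero, zero_div, sub_zero, zero_sub, neg_mul,
      intervalIntegral.integral_neg, neg_neg] at hparts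
    rw [cosKernelIntegral, ← hparts]
    exact intervalIntegral.integral_congr fun θ _ => mul_comm _ _
  rw [heq, ← intervalIntegral.integral_const_mul, ← Real.norm_eq_abs]
  refine intervalIntegral.norm_integral_le_of_norm_le Real.pi_pos.le ?_
    (((continuous_deriv_kernel_rpow hs p).const_mul _).intervalIntegrable 0 Real.pi)
  refine Filter.Eventually.of_forall fun θ hθ => ?_
  have hsin : 0 ≤ Real.sin θ := Real.sin_nonneg_of_nonneg_of_le_pi hθ.1.le hθ.2
  have hbase : 0 ≤ (s + 2 * (1 - Real.cos θ)) ^ (-p - 1) :=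
    Real.rpow_nonneg (hs.le.trans (le_kernel_base s θ)) _
  rw [norm_mul, Real.norm_eq_abs, abs_of_nonneg (by positivity), mul_comm (1 / (m:ℝ))]
  refine mul_le_mul_of_nonneg_left ?_ (by positivity)
  rw [norm_div, Real.norm_eq_abs, Real.norm_eq_abs, abs_of_pos hm']
  gcongr
  exact Real.abs_sin_le_one _

lemma abs_cosKernelIntegral_le_rpow_div {m : ℕ} (hm : 0 < m) {p s : ℝ} (hp : 0 < p)
    (hs : 0 < s) : |cosKernelIntegral m p s| ≤ (1 / m) * s ^ (-p) := by
  refine (abs_cosKernelIntegral_le_integral_deriv hm hp hs).trans ?_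
  rw [integral_deriv_kernel_rpow hs p]
  gcongr
  linarith [Real.rpow_nonneg (by linarith : 0 ≤ s + 4) (-p)]

lemma abs_cosKernelIntegral_le_rpow_sub_one_div {m : ℕ} (hm : 0 < m) {p s : ℝ} (hp : 0 < p)
    (hs : 0 < s) :
    |cosKernelIntegral m p s| ≤ (1 / m) * (2 * p * Real.pi * s ^ (-p - 1)) := by
  refine (abs_cosKernelIntegral_le_integral_deriv hm hp hs).trans ?_
  gcongr
  have h := intervalIntegral.integral_mono_on Real.pi_pos.le
    ((continuous_deriv_kernel_rpow hs p).intervalIntegrable 0 Real.pi)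
    (intervalIntegrable_const (μ := volume) (c := 2 * p * s ^ (-p - 1))) (fun θ hθ => ?_)
  · refine h.trans_eq ?_
    rw [intervalIntegral.integral_const, smul_eq_mul]
    ring
  · have hle : (s + 2 * (1 - Real.cos θ)) ^ (-p - 1) ≤ s ^ (-p - 1) :=
      Real.rpow_le_rpow_of_nonpos hs (le_kernel_base s θ) (by linarith)
    have hbase : 0 ≤ (s + 2 * (1 - Real.cos θ)) ^ (-p - 1) :=
      Real.rpow_nonneg (hs.le.trans (le_kernel_base s θ)) _
    calc 2 * p * Real.sin θ * (s + 2 * (1 - Real.cos θ)) ^ (-p - 1)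
        ≤ 2 * p * 1 * s ^ (-p - 1) := by
          gcongr
          exact Real.sin_le_one θ
      _ = 2 * p * s ^ (-p - 1) := by ring

lemma intervalIntegrable_sq_rpow {η : ℝ} (hη : 0 < η) :
    IntervalIntegrable (fun θ : ℝ => (4 / Real.pi ^ 2 * θ ^ 2) ^ (η - 1 / 2)) volume
      0 Real.pi := by
  have h : IntervalIntegrable (fun θ : ℝ => (4 / Real.pi ^ 2) ^ (η - 1 / 2) * θ ^ (2 * η - 1))
      volume 0 Real.pi :=
    (intervalIntegral.intervalIntegrable_rpow' (by linarith)).const_mul _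
  refine h.congr fun θ hθ => ?_
  rw [Set.uIoc_of_le Real.pi_pos.le] at hθ
  have hθ0 : 0 ≤ θ := hθ.1.le
  rw [Real.mul_rpow (by positivity) (by positivity), ← Real.rpow_natCast θ 2,
    ← Real.rpow_mul hθ0]
  congr 2
  push_cast
  ring

/-- The bound without oscillation, with an arbitrarily small loss `s ^ (-η)`. -/
lemma rpow_mul_abs_cosKernelIntegral_le (m : ℕ) {p s η : ℝ} (hp : 1 / 2 ≤ p) (hs : 0 < s)
    (hη : 0 < η) (hη' : η < 1 / 2) :
    s ^ (p - 1 / 2 + η) * |cosKernelIntegral m p s|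
      ≤ ∫ θ in (0:ℝ)..Real.pi, (4 / Real.pi ^ 2 * θ ^ 2) ^ (η - 1 / 2) := by
  have hbound : |cosKernelIntegral m p s|
      ≤ ∫ θ in (0:ℝ)..Real.pi, (s + 2 * (1 - Real.cos θ)) ^ (-p) := by
    rw [← Real.norm_eq_abs]
    refine intervalIntegral.norm_integral_le_of_norm_le Real.pi_pos.le
      (Filter.Eventually.of_forall fun θ _ => ?_)
      ((continuous_kernel_rpow hs _).intervalIntegrable 0 Real.pi)
    have hbase : 0 ≤ (s + 2 * (1 - Real.cos θ)) ^ (-p) :=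
      Real.rpow_nonneg (hs.le.trans (le_kernel_base s θ)) _
    rw [norm_mul, Real.norm_eq_abs, Real.norm_eq_abs, abs_of_nonneg hbase]
    exact mul_le_of_le_one_left hbase (Real.abs_cos_le_one _)
  refine (mul_le_mul_of_nonneg_left hbound (Real.rpow_nonneg hs.le _)).trans ?_
  rw [← intervalIntegral.integral_const_mul]
  refine intervalIntegral.integral_mono_on_of_le_Ioo Real.pi_pos.le
    (((continuous_kernel_rpow hs _).const_mul _).intervalIntegrable 0 Real.pi)
    (intervalIntegrable_sq_rpow hη) fun θ hθ => ?_
  have hD : 0 < s + 2 * (1 - Real.cos θ) := hs.trans_le (le_kernel_base s θ)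
  have hθ0 : 0 < θ := hθ.1
  have hcos : Real.cos θ ≤ 1 - 2 / Real.pi ^ 2 * θ ^ 2 :=
    Real.cos_le_one_sub_mul_cos_sq (by rw [abs_of_pos hθ0]; exact hθ.2.le)
  calc s ^ (p - 1 / 2 + η) * (s + 2 * (1 - Real.cos θ)) ^ (-p)
      ≤ (s + 2 * (1 - Real.cos θ)) ^ (p - 1 / 2 + η) * (s + 2 * (1 - Real.cos θ)) ^ (-p) := by
        gcongr
        exact le_kernel_base s θ
    _ = (s + 2 * (1 - Real.cos θ)) ^ (η - 1 / 2) := by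
        rw [← Real.rpow_add hD]
        congr 1
        ring
    _ ≤ (4 / Real.pi ^ 2 * θ ^ 2) ^ (η - 1 / 2) := by
        refine Real.rpow_le_rpow_of_nonpos (by positivity) ?_ (by linarith)
        have : 4 / Real.pi ^ 2 * θ ^ 2 = 2 * (2 / Real.pi ^ 2 * θ ^ 2) := by ring
        linarith

lemma exists_cosKernelIntegral_decay {δ δ' : ℝ} (hδ'0 : 0 < δ') (hδ'δ : δ' < δ) (hδ1 : δ < 1)
    {p : ℝ} (hp : 1 / 2 ≤ p) :
    ∃ C : ℝ, 0 < C ∧ ∀ m : ℕ, 0 < m → ∀ s : ℝ, 0 < s →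
      s ^ (p - 1 / 2 + δ) * |cosKernelIntegral m p s| ≤ C * (m : ℝ) ^ (-δ') := by
  set B : ℝ := ∫ θ in (0:ℝ)..Real.pi, (4 / Real.pi ^ 2 * θ ^ 2) ^ (δ' / 2 - 1 / 2) with hB
  have hB0 : 0 ≤ B := intervalIntegral.integral_nonneg Real.pi_pos.le fun θ _ => by positivity
  have hp0 : 0 < p := by linarith
  have hpi := Real.pi_pos
  refine ⟨2 * p * Real.pi + 1 + B, by positivity, fun m hm s hs => ?_⟩
  have hm1 : (1:ℝ) ≤ m := by exact_mod_cast hm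
  have hm0 : (0:ℝ) < m := by linarith
  have hmd : 0 ≤ (m:ℝ) ^ (-δ') := Real.rpow_nonneg hm0.le _
  have hsp : 0 ≤ s ^ (p - 1 / 2 + δ) := Real.rpow_nonneg hs.le _
  have hinv : (1:ℝ) / m ≤ (m:ℝ) ^ (-δ') := by
    rw [one_div, ← Real.rpow_neg_one]
    exact Real.rpow_le_rpow_of_exponent_le hm1 (by linarith)
  suffices h : ∃ c, c ≤ 2 * p * Real.pi + 1 + B ∧
      s ^ (p - 1 / 2 + δ) * |cosKernelIntegral m p s| ≤ c * (m : ℝ) ^ (-δ') by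
    obtain ⟨c, hc, h⟩ := h
    exact h.trans (mul_le_mul_of_nonneg_right hc hmd)
  rcases le_total 1 s with hs1 | hs1
  · refine ⟨2 * p * Real.pi, by linarith, ?_⟩
    have hexp : s ^ (p - 1 / 2 + δ) * s ^ (-p - 1) ≤ 1 := by
      rw [← Real.rpow_add hs]
      exact Real.rpow_le_one_of_one_le_of_nonpos hs1 (by linarith)
    calc s ^ (p - 1 / 2 + δ) * |cosKernelIntegral m p s|
        ≤ s ^ (p - 1 / 2 + δ) * ((1 / m) * (2 * p * Real.pi * s ^ (-p - 1))) :=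
          mul_le_mul_of_nonneg_left (abs_cosKernelIntegral_le_rpow_sub_one_div hm hp0 hs) hsp
      _ = 2 * p * Real.pi * (1 / m) * (s ^ (p - 1 / 2 + δ) * s ^ (-p - 1)) := by ring
      _ ≤ 2 * p * Real.pi * (1 / m) * 1 := by gcongr
      _ ≤ 2 * p * Real.pi * (m : ℝ) ^ (-δ') := by
          rw [mul_one]
          gcongr
  · have hsqrt : 0 < s ^ (1 / 2 : ℝ) := Real.rpow_pos_of_pos hs _
    rcases le_total 1 (m * s ^ (1 / 2 : ℝ)) with hms | hms
    · refine ⟨1, by linarith [mul_pos (mul_pos two_pos hp0) hpi], ?_⟩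
      have hms' : (m * s ^ (1 / 2 : ℝ)) ^ (-1 : ℝ) ≤ (m * s ^ (1 / 2 : ℝ)) ^ (-δ') :=
        Real.rpow_le_rpow_of_exponent_le hms (by linarith)
      rw [Real.mul_rpow hm0.le hsqrt.le, Real.mul_rpow hm0.le hsqrt.le, ← Real.rpow_mul hs.le,
        ← Real.rpow_mul hs.le] at hms'
      calc s ^ (p - 1 / 2 + δ) * |cosKernelIntegral m p s|
          ≤ s ^ (p - 1 / 2 + δ) * ((1 / m) * s ^ (-p)) :=
            mul_le_mul_of_nonneg_left (abs_cosKernelIntegral_le_rpow_div hm hp0 hs) hsp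
        _ = s ^ δ * ((m:ℝ) ^ (-1 : ℝ) * s ^ (1 / 2 * (-1) : ℝ)) := by
            have : s ^ (p - 1 / 2 + δ) * s ^ (-p) = s ^ δ * s ^ (1 / 2 * (-1) : ℝ) := by
              rw [← Real.rpow_add hs, ← Real.rpow_add hs]
              congr 1
              ring
            rw [Real.rpow_neg_one, one_div (m:ℝ), mul_left_comm, this, mul_left_comm]
        _ ≤ s ^ δ * ((m:ℝ) ^ (-δ') * s ^ (1 / 2 * (-δ') : ℝ)) := by gcongr
        _ = s ^ (δ - δ' / 2) * (m:ℝ) ^ (-δ') := by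
            have : s ^ δ * s ^ (1 / 2 * (-δ') : ℝ) = s ^ (δ - δ' / 2) := by
              rw [← Real.rpow_add hs]
              congr 1
              ring
            linear_combination (m:ℝ) ^ (-δ') * this
        _ ≤ 1 * (m:ℝ) ^ (-δ') := by
            gcongr
            exact Real.rpow_le_one hs.le hs1 (by linarith)
    · refine ⟨B, by linarith [mul_pos (mul_pos two_pos hp0) hpi], ?_⟩
      have hsm : s ^ (δ - δ' / 2) ≤ (m:ℝ) ^ (-δ') := by
        calc s ^ (δ - δ' / 2) ≤ s ^ (1 / 2 * δ') :=
              Real.rpow_le_rpow_of_exponent_ge hs hs1 (by linarith)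
          _ = (s ^ (1 / 2 : ℝ)) ^ δ' := Real.rpow_mul hs.le _ _
          _ ≤ ((m:ℝ)⁻¹) ^ δ' := by
              gcongr
              rwa [← one_div, le_div_iff₀' hm0]
          _ = (m:ℝ) ^ (-δ') := by rw [Real.inv_rpow hm0.le, Real.rpow_neg hm0.le]
      calc s ^ (p - 1 / 2 + δ) * |cosKernelIntegral m p s|
          = s ^ (δ - δ' / 2) * (s ^ (p - 1 / 2 + δ' / 2) * |cosKernelIntegral m p s|) := by
            rw [← mul_assoc, ← Real.rpow_add hs]
            congr 2
            ring
        _ ≤ (m:ℝ) ^ (-δ') * B := by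
            gcongr
            exact rpow_mul_abs_cosKernelIntegral_le m hp hs (by linarith) (by linarith)
        _ = B * (m:ℝ) ^ (-δ') := mul_comm _ _

lemma Fm_eq_cosKernelIntegral (m : ℕ) {s : ℝ} (hs : 0 < s) :
    Fm m s = cosKernelIntegral m (1 / 2) s := by
  refine intervalIntegral.integral_congr fun θ _ => ?_
  rw [Real.sqrt_eq_rpow, Real.rpow_neg (hs.le.trans (le_kernel_base s θ)), div_eq_mul_inv]

lemma Fm'_eq_cosKernelIntegral (m : ℕ) (s : ℝ) :
    Fm' m s = -(1 / 2) * cosKernelIntegral m (3 / 2) s := by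
  rw [Fm', cosKernelIntegral, neg_div]

lemma Fm''_eq_cosKernelIntegral (m : ℕ) (s : ℝ) :
    Fm'' m s = (3 / 4) * cosKernelIntegral m (5 / 2) s := by
  rw [Fm'', cosKernelIntegral, neg_div]

/-- Corollary 2.4 (corFm): polynomial decay in `m` of the weighted bounds on
`F_m`, `F_m'`, `F_m''`. -/
theorem Fm_polynomial_decay (δ δ' : ℝ) (hδ'0 : 0 < δ') (hδ'δ : δ' < δ) (hδ1 : δ < 1) :
    ∃ C : ℝ, 0 < C ∧ ∀ (m : ℕ), 3 ≤ m → ∀ s : ℝ, 0 < s →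
      s ^ δ * |Fm m s| + s ^ (1 + δ) * |Fm' m s| + s ^ (2 + δ) * |Fm'' m s|
        ≤ C * (m : ℝ) ^ (-δ') := by
  obtain ⟨C₀, hC₀, h₀⟩ :=
    exists_cosKernelIntegral_decay hδ'0 hδ'δ hδ1 (p := 1 / 2) (by norm_num)
  obtain ⟨C₁, hC₁, h₁⟩ :=
    exists_cosKernelIntegral_decay hδ'0 hδ'δ hδ1 (p := 3 / 2) (by norm_num)
  obtain ⟨C₂, hC₂, h₂⟩ :=
    exists_cosKernelIntegral_decay hδ'0 hδ'δ hδ1 (p := 5 / 2) (by norm_num)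
  refine ⟨C₀ + 1 / 2 * C₁ + 3 / 4 * C₂, by positivity, fun m hm s hs => ?_⟩
  have e₀ := h₀ m (by omega) s hs
  have e₁ := h₁ m (by omega) s hs
  have e₂ := h₂ m (by omega) s hs
  norm_num only [sub_self, zero_add] at e₀ e₁ e₂
  rw [Fm_eq_cosKernelIntegral m hs, Fm'_eq_cosKernelIntegral, Fm''_eq_cosKernelIntegral,
    abs_mul, abs_mul, abs_neg, abs_of_pos (by norm_num : (0:ℝ) < 1 / 2),
    abs_of_pos (by norm_num : (0:ℝ) < 3 / 4)]
  linarith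

end
end

section
/- Let m ≥ 3 be an integer, let 1 < q < p < ∞, and let α, β ∈ ℝ satisfy α + β > 0, α + 1/p ≥ −3, β − 1/q ≥ −2, and 1/q = 1/p + (α+β)/3. Then for every sufficiently small ε > 0 there is a constant C_ε, independent of m and f, such that for every smooth function f compactly supported in (0,∞)×ℝ: ‖r^{α} L_m^{-1}(r^{β−2} f)‖_{L^p} ≤ C_ε m^{−(1 + 1/p − 1/q − ε)} ‖f‖_{L^q}. If in addition 1/2 + 1/p − 1/q > 0, then also ‖r^{α} L_m^{-1}((1/r) ∇̃(r^{β} f))‖_{L^p} + ‖r^{α} L_m^{-1}(∇̃(r^{β−1} f))‖_{L^p} ≤ C_ε m^{−(1/2 + 1/p − 1/q − ε)} ‖f‖_{L^q}. -/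
open Real MeasureTheory Set

noncomputable section

/-- `ξ² = ((r − r̄)² + (z − z̄)²)/(r r̄)`. -/
def xiSq (r r' z z' : ℝ) : ℝ := ((r - r')^2 + (z - z')^2) / (r * r')

/-- The explicit integral kernel realisation of
`L_m^{-1} = (−(∂_r² + ∂_r/r + ∂_z²) + m²/r²)^{-1}` on axisymmetric functions. -/
def Lminv (m : ℕ) (g : ℝ → ℝ → ℝ) (r z : ℝ) : ℝ :=
  (1/(2*Real.pi)) * ∫ r' in Set.Ioi (0:ℝ), ∫ z' : ℝ,
    Fm m (xiSq r r' z z') * g r' z' * Real.sqrt (r'/r)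

/-- The `L^p(ℝ³)` norm of the axisymmetric function corresponding to `f(r,z)`:
`‖f‖_{L^p}^p = 2π ∫₀^∞ ∫_ℝ |f(r,z)|^p r dz dr`. -/
def cylLp (p : ℝ) (f : ℝ → ℝ → ℝ) : ℝ :=
  (2*Real.pi * ∫ r in Set.Ioi (0:ℝ), ∫ z : ℝ, |f r z| ^ p * r) ^ (1/p)

/-- A smooth function compactly supported in `(0,∞) × ℝ`. -/
def TestFun (f : ℝ → ℝ → ℝ) : Prop :=
  ContDiff ℝ (⊤ : ℕ∞) (Function.uncurry f) ∧ HasCompactSupport (Function.uncurry f) ∧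
    tsupport (Function.uncurry f) ⊆ Set.Ioi (0:ℝ) ×ˢ Set.univ

section Helpers

open scoped ENNReal

/-- `∫₀^π cos(mθ) (s + 2(1 - cos θ))^{-ν} dθ`. -/
def cosKernel (m : ℕ) (ν s : ℝ) : ℝ :=
  ∫ θ in (0:ℝ)..π, cos (m * θ) * (s + 2 * (1 - cos θ)) ^ (-ν)

lemma base_ge (s θ : ℝ) : s ≤ s + 2 * (1 - cos θ) := by
  linarith [cos_le_one θ]

lemma base_pos {s : ℝ} (hs : 0 < s) (θ : ℝ) : 0 < s + 2 * (1 - cos θ) :=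
  hs.trans_le (base_ge s θ)

lemma continuous_base_rpow {s : ℝ} (hs : 0 < s) (ν : ℝ) :
    Continuous fun θ : ℝ => (s + 2 * (1 - cos θ)) ^ (-ν) := by
  refine Continuous.rpow_const (by fun_prop) fun θ => Or.inl (base_pos hs θ).ne'

lemma continuous_cosKernel_integrand {s : ℝ} (hs : 0 < s) (m : ℕ) (ν : ℝ) :
    Continuous fun θ : ℝ => cos (m * θ) * (s + 2 * (1 - cos θ)) ^ (-ν) :=
  Continuous.mul (by fun_prop) (continuous_base_rpow hs ν)

lemma Fm_eq_cosKernel (m : ℕ) {s : ℝ} (hs : 0 < s) : Fm m s = cosKernel m (1/2) s := by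
  unfold Fm cosKernel
  refine intervalIntegral.integral_congr fun θ _ => ?_
  rw [rpow_neg (base_pos hs θ).le, ← sqrt_eq_rpow, div_eq_mul_inv]

lemma hasDerivAt_cosKernel (m : ℕ) {ν s : ℝ} (hν : 0 ≤ ν) (hs : 0 < s) :
    HasDerivAt (cosKernel m ν) (-ν * cosKernel m (ν + 1) s) s := by
  have key := (intervalIntegral.hasDerivAt_integral_of_dominated_loc_of_deriv_le
    (μ := volume) (a := 0) (b := π) (s := Ioi (s/2)) (x₀ := s)
    (F := fun s θ => cos (m * θ) * (s + 2 * (1 - cos θ)) ^ (-ν))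
    (F' := fun s θ => cos (m * θ) * (-ν * (s + 2 * (1 - cos θ)) ^ (-(ν + 1))))
    (bound := fun _ => ν * (s/2) ^ (-(ν + 1)))
    (Ioi_mem_nhds (by linarith)) ?_ ?_ ?_ ?_ ?_ ?_).2
  · refine key.congr_deriv ?_
    rw [cosKernel, ← intervalIntegral.integral_const_mul]
    congr 1 with θ
    ring
  · filter_upwards [Ioi_mem_nhds hs] with x hx
    exact (continuous_cosKernel_integrand hx m ν).aestronglyMeasurable
  · exact (continuous_cosKernel_integrand hs m ν).intervalIntegrable _ _
  · exact (Continuous.mul (by fun_prop)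
      (continuous_const.mul (continuous_base_rpow hs _))).aestronglyMeasurable
  · refine Filter.Eventually.of_forall fun θ _ x hx => ?_
    have hx0 : 0 < x := lt_trans (by linarith) hx
    have h1 : (x + 2 * (1 - cos θ)) ^ (-(ν + 1)) ≤ (s/2) ^ (-(ν + 1)) :=
      rpow_le_rpow_of_nonpos (by linarith) (le_trans (le_of_lt hx) (base_ge x θ)) (by linarith)
    have h2 : 0 ≤ (x + 2 * (1 - cos θ)) ^ (-(ν + 1)) := rpow_nonneg (base_pos hx0 θ).le _
    rw [norm_mul, norm_mul, norm_neg, Real.norm_of_nonneg hν, Real.norm_of_nonneg h2]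
    calc |cos (m * θ)| * (ν * (x + 2 * (1 - cos θ)) ^ (-(ν + 1)))
        ≤ 1 * (ν * (s/2) ^ (-(ν + 1))) := by
          gcongr
          exact abs_cos_le_one _
      _ = _ := one_mul _
  · exact intervalIntegrable_const
  · refine Filter.Eventually.of_forall fun θ _ x hx => ?_
    have hx0 : 0 < x := lt_trans (by linarith) hx
    have h := ((hasDerivAt_id x).add_const (2 * (1 - cos θ))).rpow_const (p := -ν)
      (Or.inl (base_pos hx0 θ).ne')
    refine (h.const_mul (cos (m * θ))).congr_deriv ?_
    simp only [id]
    rw [show -(ν + 1) = -ν - 1 by ring]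
    ring

lemma continuousOn_cosKernel (m : ℕ) {ν : ℝ} (hν : 0 ≤ ν) :
    ContinuousOn (cosKernel m ν) (Ioi 0) := fun _ hs =>
  (hasDerivAt_cosKernel m hν hs).continuousAt.continuousWithinAt

lemma cosKernel_recursion {m : ℕ} (hm : 1 ≤ m) (ν : ℝ) {s : ℝ} (hs : 0 < s) :
    cosKernel m ν s =
      ν / m * (cosKernel (m - 1) (ν + 1) s - cosKernel (m + 1) (ν + 1) s) := by
  have hm0 : (m : ℝ) ≠ 0 := by positivity
  have hu : ∀ θ ∈ uIcc (0:ℝ) π, HasDerivAt (fun θ : ℝ => (s + 2 * (1 - cos θ)) ^ (-ν))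
      (2 * sin θ * (-ν) * (s + 2 * (1 - cos θ)) ^ (-(ν + 1))) θ := fun θ _ => by
    have h := ((((hasDerivAt_cos θ).const_sub 1).const_mul 2).const_add s).rpow_const (p := -ν)
      (Or.inl (base_pos hs θ).ne')
    refine h.congr_deriv ?_
    rw [show -(ν + 1) = -ν - 1 by ring]
    ring
  have hv : ∀ θ ∈ uIcc (0:ℝ) π, HasDerivAt (fun θ : ℝ => sin (m * θ) / m) (cos (m * θ)) θ :=
    fun θ _ => by
    have h := (((hasDerivAt_id θ).const_mul (m:ℝ)).sin).div_const (m:ℝ)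
    refine h.congr_deriv ?_
    simp only [id]
    field_simp
  have hc := continuous_base_rpow hs (ν + 1)
  have key := intervalIntegral.integral_mul_deriv_eq_deriv_mul hu hv
    (Continuous.intervalIntegrable (by fun_prop) _ _)
    (Continuous.intervalIntegrable (by fun_prop) _ _)
  have hsin : sin (m * π) = 0 := sin_nat_mul_pi m
  simp only [hsin, mul_zero, sin_zero, zero_div, sub_zero, zero_sub] at key
  have h0 : cosKernel m ν s = ∫ θ in (0:ℝ)..π, (s + 2 * (1 - cos θ)) ^ (-ν) * cos (m * θ) := by
    unfold cosKernel; congr 1 with θ; ring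
  rw [h0, key]
  unfold cosKernel
  rw [← intervalIntegral.integral_sub
    ((continuous_cosKernel_integrand hs _ _).intervalIntegrable _ _)
    ((continuous_cosKernel_integrand hs _ _).intervalIntegrable _ _),
    ← intervalIntegral.integral_const_mul, ← intervalIntegral.integral_neg]
  congr 1 with θ
  have e1 : (((m - 1 : ℕ) : ℝ) * θ) = m * θ - θ := by
    rw [Nat.cast_sub hm]; push_cast; ring
  have e2 : (((m + 1 : ℕ) : ℝ) * θ) = m * θ + θ := by push_cast; ring
  rw [e1, e2, cos_sub, cos_add]
  field_simp
  ring

lemma abs_cosKernel_le_integral (m : ℕ) (ν : ℝ) {s : ℝ} (hs : 0 < s) {g : ℝ → ℝ}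
    (hg : IntervalIntegrable g volume 0 π)
    (h : ∀ θ ∈ Ioc 0 π, (s + 2 * (1 - cos θ)) ^ (-ν) ≤ g θ) :
    |cosKernel m ν s| ≤ ∫ θ in (0:ℝ)..π, g θ := by
  unfold cosKernel
  rw [← Real.norm_eq_abs]
  refine intervalIntegral.norm_integral_le_of_norm_le pi_pos.le
    (Filter.Eventually.of_forall fun θ hθ => ?_) hg
  rw [norm_mul, Real.norm_of_nonneg (rpow_nonneg (base_pos hs θ).le _)]
  calc |cos (m * θ)| * (s + 2 * (1 - cos θ)) ^ (-ν)
      ≤ 1 * (s + 2 * (1 - cos θ)) ^ (-ν) := by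
        gcongr
        · exact rpow_nonneg (base_pos hs θ).le _
        · exact abs_cos_le_one _
    _ ≤ g θ := by rw [one_mul]; exact h θ hθ

lemma abs_cosKernel_le (m : ℕ) {ν s : ℝ} (hν : 0 ≤ ν) (hs : 0 < s) :
    |cosKernel m ν s| ≤ π * s ^ (-ν) := by
  have := abs_cosKernel_le_integral m ν hs (g := fun _ => s ^ (-ν)) intervalIntegrable_const
    (fun θ _ => rpow_le_rpow_of_nonpos hs (base_ge s θ) (by linarith))
  simpa using this

lemma abs_cosKernel_le_of_le {n m : ℕ} (hm : n + 1 ≤ m) {ν s B : ℝ} (hν : 0 ≤ ν) (hs : 0 < s)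
    (h : ∀ k, n ≤ k → |cosKernel k (ν + 1) s| ≤ B) :
    |cosKernel m ν s| ≤ (m:ℝ)⁻¹ * (2 * ν * B) := by
  rw [cosKernel_recursion (by omega) ν hs, abs_mul, abs_of_nonneg (by positivity)]
  have h1 := h (m - 1) (by omega)
  have h2 := h (m + 1) (by omega)
  have h3 := abs_sub (cosKernel (m - 1) (ν + 1) s) (cosKernel (m + 1) (ν + 1) s)
  calc ν / m * |cosKernel (m - 1) (ν + 1) s - cosKernel (m + 1) (ν + 1) s|
      ≤ ν / m * (B + B) := by gcongr; linarith
    _ = _ := by ring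

lemma abs_cosKernel_le_of_le' {n m : ℕ} (hm : n + 1 ≤ m) {ν s B : ℝ} (hν : 0 ≤ ν) (hs : 0 < s)
    (h : ∀ k, n ≤ k → |cosKernel k (ν + 1) s| ≤ B) :
    |cosKernel m ν s| ≤ 2 * ν * B := by
  have hB : 0 ≤ B := (abs_nonneg _).trans (h n le_rfl)
  refine (abs_cosKernel_le_of_le hm hν hs h).trans ?_
  have : (m:ℝ)⁻¹ ≤ 1 := inv_le_one_of_one_le₀ (by exact_mod_cast (by omega : 1 ≤ m))
  exact mul_le_of_le_one_left (by positivity) this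

lemma abs_cosKernel_le_decay {ν : ℝ} (hν : 0 ≤ ν) {m : ℕ} (hm : 3 ≤ m) {s : ℝ} (hs : 0 < s) :
    |cosKernel m ν s| ≤
      (m:ℝ)⁻¹ * (2 * ν * (2 * (ν + 1) * (2 * (ν + 2) * (π * s ^ (-(ν + 3)))))) := by
  refine abs_cosKernel_le_of_le (n := 2) hm hν hs fun k hk => ?_
  refine abs_cosKernel_le_of_le' (n := 1) hk (by linarith) hs fun k hk => ?_
  rw [show ν + 1 + 1 = ν + 2 by ring]
  refine abs_cosKernel_le_of_le' (n := 0) hk (by linarith) hs fun k hk => ?_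
  rw [show ν + 2 + 1 = ν + 3 by ring]
  exact abs_cosKernel_le k (by linarith) hs

lemma exists_abs_cosKernel_le (ν : ℝ) (hν : 1/2 ≤ ν) (η : ℝ) (hη : 0 < η) (hη1 : η < 1) :
    ∃ C : ℝ, 0 < C ∧ ∀ (m : ℕ) (s : ℝ), 0 < s →
      |cosKernel m ν s| ≤ C * s ^ (-(ν - 1/2 + η/2)) := by
  have hint : IntervalIntegrable (fun θ : ℝ => θ ^ (-(1 - η))) volume 0 π :=
    intervalIntegral.intervalIntegrable_rpow' (by linarith)
  set I := ∫ θ in (0:ℝ)..π, θ ^ (-(1 - η))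
  have hI : 0 ≤ I := intervalIntegral.integral_nonneg pi_pos.le
    fun θ hθ => rpow_nonneg hθ.1 _
  refine ⟨(4 / π ^ 2) ^ (-((1 - η)/2)) * I + 1, by positivity, fun m s hs => ?_⟩
  have h := abs_cosKernel_le_integral m ν hs
    (g := fun θ => s ^ (-(ν - 1/2 + η/2)) * (4 / π ^ 2) ^ (-((1 - η)/2)) * θ ^ (-(1 - η)))
    (hint.const_mul _) ?_
  · refine h.trans ?_
    rw [intervalIntegral.integral_const_mul]
    have : 0 ≤ s ^ (-(ν - 1/2 + η/2)) := by positivity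
    calc _ = ((4 / π ^ 2) ^ (-((1 - η)/2)) * I) * s ^ (-(ν - 1/2 + η/2)) := by ring
      _ ≤ _ := by gcongr; linarith
  · intro θ hθ
    have hθ0 : 0 < θ := hθ.1
    have hb : 4 / π ^ 2 * θ ^ 2 ≤ s + 2 * (1 - cos θ) := by
      have := cos_le_one_sub_mul_cos_sq (x := θ) (by rw [abs_of_pos hθ0]; exact hθ.2)
      have e : 4 / π ^ 2 * θ ^ 2 = 2 * (2 / π ^ 2 * θ ^ 2) := by ring
      linarith
    have e0 : -ν = -(ν - 1/2 + η/2) + -((1 - η)/2) := by ring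
    rw [e0, rpow_add (base_pos hs θ)]
    have h1 : (s + 2 * (1 - cos θ)) ^ (-(ν - 1/2 + η/2)) ≤ s ^ (-(ν - 1/2 + η/2)) :=
      rpow_le_rpow_of_nonpos hs (base_ge s θ) (by linarith)
    have h2 : (s + 2 * (1 - cos θ)) ^ (-((1 - η)/2)) ≤ (4 / π ^ 2 * θ ^ 2) ^ (-((1 - η)/2)) :=
      rpow_le_rpow_of_nonpos (by positivity) hb (by linarith)
    have h3 : (4 / π ^ 2 * θ ^ 2) ^ (-((1 - η)/2))
        = (4 / π ^ 2) ^ (-((1 - η)/2)) * θ ^ (-(1 - η)) := by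
      rw [mul_rpow (by positivity) (by positivity), ← rpow_natCast θ 2, ← rpow_mul hθ0.le]
      congr 2
      push_cast; ring
    rw [h3] at h2
    calc _ ≤ s ^ (-(ν - 1/2 + η/2)) * ((4 / π ^ 2) ^ (-((1 - η)/2)) * θ ^ (-(1 - η))) := by
          gcongr
          exact rpow_nonneg (base_pos hs θ).le _
      _ = _ := by ring

/-- The majorant `s^{-γ} (1 + s)^{-(7/2 - γ)}`. -/
def decayKernel (γ s : ℝ) : ℝ := s ^ (-γ) * (1 + s) ^ (-(7/2 - γ))

lemma decayKernel_nonneg (γ : ℝ) {s : ℝ} (hs : 0 ≤ s) : 0 ≤ decayKernel γ s := by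
  unfold decayKernel; positivity

lemma le_mul_rpow_of_le {x a y θ : ℝ} (hx : 0 ≤ x) (hy : 0 ≤ y) (ha : 0 ≤ a) (hθ : 0 ≤ θ)
    (hθ1 : θ ≤ 1) (h1 : x ≤ a) (h2 : x ≤ a * y) : x ≤ a * y ^ θ := by
  rcases hx.eq_or_lt with rfl | hx
  · positivity
  have ha' : 0 < a := hx.trans_le h1
  calc x = x ^ (1 - θ) * x ^ θ := by rw [← rpow_add hx]; simp
    _ ≤ a ^ (1 - θ) * (a * y) ^ θ := by gcongr
    _ = (a ^ (1 - θ) * a ^ θ) * y ^ θ := by rw [mul_rpow ha hy]; ring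
    _ = a * y ^ θ := by rw [← rpow_add ha']; simp

lemma exists_abs_cosKernel_le_interp {ν θ η : ℝ} (hν : 1/2 ≤ ν) (hη : 0 < η) (hη1 : η < 1)
    (hθ : 0 ≤ θ) (hθ1 : θ ≤ 1) :
    ∃ C : ℝ, 0 < C ∧ ∀ m : ℕ, 3 ≤ m → ∀ s : ℝ, 0 < s →
      |cosKernel m ν s| ≤ C * (m:ℝ) ^ (-θ) * s ^ (-(ν - 1/2 + θ + η/2)) ∧
      |cosKernel m ν s| ≤ C * (m:ℝ) ^ (-θ) * s ^ (-(ν + 3)) := by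
  obtain ⟨C₀, hC₀, h₀⟩ := exists_abs_cosKernel_le ν hν η hη hη1
  obtain ⟨C₁, hC₁, h₁⟩ := exists_abs_cosKernel_le (ν + 1) (by linarith) η hη hη1
  have hν0 : 0 < ν := by linarith
  set C₂ := 2 * ν * (2 * (ν + 1) * (2 * (ν + 2) * π))
  have hC₂ : 0 < C₂ := by positivity
  refine ⟨C₀ + 2 * ν * C₁ + C₂, by positivity, fun m hm s hs => ⟨?_, ?_⟩⟩
  · have hm0 : (0:ℝ) < m := by exact_mod_cast (by omega : 0 < m)
    have ha := h₀ m s hs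
    have hb := abs_cosKernel_le_of_le (n := 0) (m := m) (by omega) hν0.le hs
      (fun k _ => h₁ k s hs)
    set e := ν - 1/2 + η/2
    have e1 : s ^ (-(ν + 1 - 1/2 + η/2)) = s ^ (-e) * s⁻¹ := by
      rw [← rpow_neg_one s, ← rpow_add hs]; congr 1; simp only [e]; ring
    rw [e1] at hb
    have h := le_mul_rpow_of_le (x := |cosKernel m ν s|) (a := (C₀ + 2 * ν * C₁) * s ^ (-e))
      (y := (m:ℝ)⁻¹ * s⁻¹) (θ := θ) (abs_nonneg _) (by positivity) (by positivity) hθ hθ1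
      (ha.trans (by gcongr; linarith [mul_pos hν0 hC₁])) (hb.trans ?_)
    · refine h.trans ?_
      have e2 : ((m:ℝ)⁻¹ * s⁻¹) ^ θ = (m:ℝ) ^ (-θ) * s ^ (-θ) := by
        rw [mul_rpow (by positivity) (by positivity), inv_rpow hm0.le, inv_rpow hs.le,
          rpow_neg hm0.le, rpow_neg hs.le]
      have e3 : s ^ (-(ν - 1/2 + θ + η/2)) = s ^ (-e) * s ^ (-θ) := by
        rw [← rpow_add hs]; congr 1; simp only [e]; ring
      rw [e2, e3]
      have : 0 ≤ (m:ℝ) ^ (-θ) * (s ^ (-e) * s ^ (-θ)) := by positivity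
      calc _ = (C₀ + 2 * ν * C₁) * ((m:ℝ) ^ (-θ) * (s ^ (-e) * s ^ (-θ))) := by ring
        _ ≤ (C₀ + 2 * ν * C₁ + C₂) * ((m:ℝ) ^ (-θ) * (s ^ (-e) * s ^ (-θ))) :=
          mul_le_mul_of_nonneg_right (by linarith) this
        _ = _ := by ring
    · have : 0 ≤ s ^ (-e) * ((m:ℝ)⁻¹ * s⁻¹) := by positivity
      calc _ = (2 * ν * C₁) * (s ^ (-e) * ((m:ℝ)⁻¹ * s⁻¹)) := by ring
        _ ≤ (C₀ + 2 * ν * C₁) * (s ^ (-e) * ((m:ℝ)⁻¹ * s⁻¹)) := by gcongr; linarith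
        _ = _ := by ring
  · have h := abs_cosKernel_le_decay hν0.le hm hs
    have hm1 : (1:ℝ) ≤ m := by exact_mod_cast (by omega : 1 ≤ m)
    have e : (m:ℝ)⁻¹ ≤ (m:ℝ) ^ (-θ) := by
      rw [← rpow_neg_one]
      exact rpow_le_rpow_of_exponent_le hm1 (by linarith)
    calc _ ≤ _ := h
      _ = C₂ * (m:ℝ)⁻¹ * s ^ (-(ν + 3)) := by simp only [C₂]; ring
      _ ≤ _ := by gcongr; linarith [mul_pos hν0 hC₁]

lemma le_decayKernel {A B γ s : ℝ} (hs : 0 < s) (hB : 0 ≤ B) (hγ : 0 ≤ γ) (hγ' : γ ≤ 7/2)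
    (h1 : s ≤ 1 → A ≤ B * s ^ (-γ)) (h2 : 1 ≤ s → A ≤ B * s ^ (-(7/2 : ℝ))) :
    A ≤ 2 ^ (7/2 : ℝ) * B * decayKernel γ s := by
  have hd : (1:ℝ) ≤ 2 ^ (7/2 : ℝ) * 2 ^ (-(7/2 - γ)) := by
    rw [← rpow_add two_pos]; exact one_le_rpow (by norm_num) (by linarith)
  unfold decayKernel
  rcases le_total s 1 with h | h
  · have : (2:ℝ) ^ (-(7/2 - γ)) ≤ (1 + s) ^ (-(7/2 - γ)) :=
      rpow_le_rpow_of_nonpos (by linarith) (by linarith) (by linarith)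
    calc A ≤ 1 * (B * s ^ (-γ)) := by rw [one_mul]; exact h1 h
      _ ≤ (2 ^ (7/2 : ℝ) * 2 ^ (-(7/2 - γ))) * (B * s ^ (-γ)) := by gcongr
      _ ≤ (2 ^ (7/2 : ℝ) * (1 + s) ^ (-(7/2 - γ))) * (B * s ^ (-γ)) := by gcongr
      _ = _ := by ring
  · have : (2:ℝ) ^ (-(7/2 - γ)) * s ^ (-(7/2 - γ)) ≤ (1 + s) ^ (-(7/2 - γ)) := by
      rw [← mul_rpow (by norm_num) hs.le]
      exact rpow_le_rpow_of_nonpos (by linarith) (by linarith) (by linarith)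
    have e : s ^ (-(7/2 : ℝ)) = s ^ (-γ) * s ^ (-(7/2 - γ)) := by
      rw [← rpow_add hs]; congr 1; ring
    calc A ≤ 1 * (B * s ^ (-(7/2:ℝ))) := by rw [one_mul]; exact h2 h
      _ ≤ (2 ^ (7/2 : ℝ) * 2 ^ (-(7/2 - γ))) * (B * s ^ (-(7/2:ℝ))) := by gcongr
      _ = 2 ^ (7/2 : ℝ) * B * (s ^ (-γ) * (2 ^ (-(7/2 - γ)) * s ^ (-(7/2 - γ)))) := by
        rw [e]; ring
      _ ≤ _ := by gcongr

/-- Size of `F_m`, uniformly in `m`. -/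
lemma exists_abs_cosKernel_half_le {θ η : ℝ} (hη : 0 < η) (hη1 : η < 1)
    (hθ : 0 ≤ θ) (hθ1 : θ ≤ 1) :
    ∃ C : ℝ, 0 < C ∧ ∀ m : ℕ, 3 ≤ m → ∀ s : ℝ, 0 < s →
      |cosKernel m (1/2) s| ≤ C * (m:ℝ) ^ (-θ) * decayKernel (θ + η/2) s := by
  obtain ⟨C, hC, h⟩ := exists_abs_cosKernel_le_interp (ν := 1/2) le_rfl hη hη1 hθ hθ1
  refine ⟨2 ^ (7/2 : ℝ) * C, by positivity, fun m hm s hs => ?_⟩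
  obtain ⟨h1, h2⟩ := h m hm s hs
  have := le_decayKernel (A := |cosKernel m (1/2) s|) (B := C * (m:ℝ) ^ (-θ)) (γ := θ + η/2) hs
    (by positivity) (by linarith) (by linarith)
    (fun _ => by convert h1 using 3; ring) (fun _ => by convert h2 using 3; ring)
  convert this using 1; ring

/-- Size of the derivative of `F_m`, uniformly in `m`. -/
lemma exists_abs_cosKernel_three_half_le {θ η : ℝ} (hη : 0 < η) (hη1 : η < 1)
    (hθ : 0 ≤ θ) (hθ1 : θ ≤ 1) :
    ∃ C : ℝ, 0 < C ∧ ∀ m : ℕ, 3 ≤ m → ∀ s : ℝ, 0 < s →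
      (√s + s) * |cosKernel m (3/2) s| ≤
        C * (m:ℝ) ^ (-θ) * decayKernel (1/2 + θ + η/2) s := by
  obtain ⟨C, hC, h⟩ := exists_abs_cosKernel_le_interp (ν := 3/2) (by norm_num) hη hη1 hθ hθ1
  refine ⟨2 ^ (7/2 : ℝ) * (2 * C), by positivity, fun m hm s hs => ?_⟩
  obtain ⟨h1, h2⟩ := h m hm s hs
  have := le_decayKernel (A := (√s + s) * |cosKernel m (3/2) s|) (B := 2 * C * (m:ℝ) ^ (-θ))
    (γ := 1/2 + θ + η/2) hs
    (by positivity) (by linarith) (by linarith) (fun hs1 => ?_) (fun hs1 => ?_)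
  · convert this using 1; ring
  · have hle : s ≤ √s := Real.le_sqrt_of_sq_le (by nlinarith)
    calc _ ≤ (√s + √s) * (C * (m:ℝ) ^ (-θ) * s ^ (-(3/2 - 1/2 + θ + η/2))) := by gcongr
      _ = 2 * C * (m:ℝ) ^ (-θ) * (s ^ (1/2 : ℝ) * s ^ (-(3/2 - 1/2 + θ + η/2))) := by
        rw [sqrt_eq_rpow]; ring
      _ = _ := by rw [← rpow_add hs]; congr 2; ring
  · have hle : √s ≤ s := Real.sqrt_le_iff.2 ⟨hs.le, by nlinarith⟩
    calc _ ≤ (s + s) * (C * (m:ℝ) ^ (-θ) * s ^ (-(3/2 + 3 : ℝ))) := by gcongr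
      _ = 2 * C * (m:ℝ) ^ (-θ) * (s ^ (1 : ℝ) * s ^ (-(3/2 + 3 : ℝ))) := by
        rw [rpow_one]; ring
      _ = _ := by rw [← rpow_add hs]; congr 2; ring

lemma lintegral_comp_sub_div {f : ℝ → ℝ≥0∞} (hf : Measurable f) {r : ℝ} (hr : 0 < r) (z : ℝ) :
    ∫⁻ x, f ((x - z) / r) = ENNReal.ofReal r * ∫⁻ x, f x := by
  rw [lintegral_sub_right_eq_self (fun x => f (x / r)) z]
  conv_lhs => rw [← Real.smul_map_volume_mul_left hr.ne']
  rw [lintegral_smul_measure, lintegral_map (by fun_prop) (by fun_prop), abs_of_pos hr]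
  simp only [mul_div_cancel_left₀ _ hr.ne', smul_eq_mul]

lemma setLIntegral_Ioi_comp_div {f : ℝ → ℝ≥0∞} (hf : Measurable f) {r : ℝ} (hr : 0 < r) :
    ∫⁻ x in Ioi (0:ℝ), f (x / r) = ENNReal.ofReal r * ∫⁻ x in Ioi (0:ℝ), f x := by
  have h := lintegral_comp_sub_div (hf.indicator measurableSet_Ioi (s := Ioi (0:ℝ))) hr 0
  rw [lintegral_indicator measurableSet_Ioi] at h
  rw [← h, ← lintegral_indicator measurableSet_Ioi]
  refine lintegral_congr fun x => ?_
  simp only [sub_zero, indicator, mem_Ioi, div_pos_iff_of_pos_right hr]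

lemma integrableOn_rpow_abs_mul_Ioi {g b : ℝ} (hg : 0 < g) (hg1 : g < 1)
    (hgb : 1 < g + 2 * b) :
    IntegrableOn (fun x : ℝ => |x| ^ (-g) * (1 + x ^ 2) ^ (-b)) (Ioi 0) := by
  have hmeas : Measurable (fun x : ℝ => |x| ^ (-g) * (1 + x ^ 2) ^ (-b)) := by fun_prop
  rw [← Ioc_union_Ioi_eq_Ioi (zero_le_one (α := ℝ)), integrableOn_union]
  constructor
  · have hi : IntegrableOn (fun x : ℝ => x ^ (-g)) (Ioc 0 1) :=
      (intervalIntegrable_iff_integrableOn_Ioc_of_le zero_le_one).1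
        (intervalIntegral.intervalIntegrable_rpow' (by linarith))
    refine Integrable.mono' hi hmeas.aestronglyMeasurable ?_
    filter_upwards [ae_restrict_mem measurableSet_Ioc] with x hx
    have hx0 : 0 < x := hx.1
    rw [Real.norm_of_nonneg (by positivity), abs_of_pos hx0]
    exact mul_le_of_le_one_right (by positivity)
      (rpow_le_one_of_one_le_of_nonpos (by nlinarith) (by linarith))
  · refine Integrable.mono' (integrableOn_Ioi_rpow_of_lt (a := -g - 2 * b) (by linarith) one_pos)
      hmeas.aestronglyMeasurable ?_
    filter_upwards [ae_restrict_mem measurableSet_Ioi] with x hx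
    have hx0 : 0 < x := lt_trans one_pos hx
    rw [Real.norm_of_nonneg (by positivity), abs_of_pos hx0]
    have h : (1 + x ^ 2) ^ (-b) ≤ x ^ (-(2 * b)) := by
      rw [show x ^ (-(2 * b)) = (x ^ 2) ^ (-b) by
        rw [← rpow_natCast x 2, ← rpow_mul hx0.le]; congr 1; push_cast; ring]
      exact rpow_le_rpow_of_nonpos (by positivity) (by linarith) (by linarith)
    calc _ ≤ x ^ (-g) * x ^ (-(2 * b)) := by gcongr
      _ = _ := by rw [← rpow_add hx0]; ring_nf

lemma integrable_rpow_abs_mul {g b : ℝ} (hg : 0 < g) (hg1 : g < 1)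
    (hgb : 1 < g + 2 * b) :
    Integrable (fun x : ℝ => |x| ^ (-g) * (1 + x ^ 2) ^ (-b)) := by
  have h := integrableOn_rpow_abs_mul_Ioi hg hg1 hgb
  rw [← integrableOn_univ, ← Iic_union_Ioi (a := (0:ℝ)), integrableOn_union]
  refine ⟨?_, h⟩
  rw [integrableOn_Iic_iff_integrableOn_Iio]
  simpa [Function.comp_def] using
    ((Measure.measurePreserving_neg (volume : Measure ℝ)).integrableOn_comp_preimage
      (Homeomorph.neg ℝ).measurableEmbedding).2 h

lemma integrableOn_rpow_mul_abs_one_sub {g b P : ℝ} (hg : 0 < g) (hg1 : g < 1) (hb : 0 ≤ b)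
    (hP : -1 < P) (hPb : P - g - 2 * b < -1) :
    IntegrableOn (fun x : ℝ => x ^ P * |1 - x| ^ (-g) * (1 + x ^ 2) ^ (-b)) (Ioi 0) := by
  have hmeas : Measurable (fun x : ℝ => x ^ P * |1 - x| ^ (-g) * (1 + x ^ 2) ^ (-b)) := by
    fun_prop
  have hle : ∀ x : ℝ, (1 + x ^ 2) ^ (-b) ≤ 1 := fun x =>
    rpow_le_one_of_one_le_of_nonpos (by nlinarith) (by linarith)
  rw [← Ioc_union_Ioi_eq_Ioi (zero_le_two (α := ℝ)), integrableOn_union]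
  constructor
  · rw [← Ioc_union_Ioc_eq_Ioc (a := (0:ℝ)) (b := 1/2) (c := 2) (by norm_num) (by norm_num),
      integrableOn_union]
    constructor
    · have hi : IntegrableOn (fun x : ℝ => x ^ P) (Ioc 0 (1/2)) :=
        (intervalIntegrable_iff_integrableOn_Ioc_of_le (by norm_num)).1
          (intervalIntegral.intervalIntegrable_rpow' hP)
      refine Integrable.mono' (hi.mul_const ((1/2) ^ (-g))) hmeas.aestronglyMeasurable ?_
      filter_upwards [ae_restrict_mem measurableSet_Ioc] with x hx
      have hx0 : 0 < x := hx.1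
      have hx1 : (1/2 : ℝ) ≤ |1 - x| := by
        rw [abs_of_nonneg (by linarith [hx.2])]; linarith [hx.2]
      rw [Real.norm_of_nonneg (by positivity)]
      have := rpow_le_rpow_of_nonpos (by norm_num) hx1 (show -g ≤ 0 by linarith)
      exact (mul_le_of_le_one_right (by positivity) (hle x)).trans (by gcongr)
    · have hi : IntegrableOn (fun x : ℝ => |1 - x| ^ (-g)) (Ioc (1/2) 2) := by
        have h0 := (integrable_rpow_abs_mul (b := 1) hg hg1 (by linarith))
        have h1 := (h0.comp_sub_left 1).const_mul 2
        refine Integrable.mono' h1.integrableOn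
          (Measurable.aestronglyMeasurable (by fun_prop)) ?_
        filter_upwards [ae_restrict_mem measurableSet_Ioc] with x hx
        rw [Real.norm_of_nonneg (by positivity)]
        have : (1/2 : ℝ) ≤ (1 + (1 - x) ^ 2) ^ (-1 : ℝ) := by
          rw [rpow_neg_one, one_div]
          exact inv_anti₀ (by positivity) (by nlinarith [hx.1, hx.2])
        calc |1 - x| ^ (-g) = 2 * (|1 - x| ^ (-g) * (1/2)) := by ring
          _ ≤ _ := by gcongr
      have hc : ∃ K : ℝ, ∀ x ∈ Icc (1/2 : ℝ) 2, ‖x ^ P‖ ≤ K :=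
        isCompact_Icc.exists_bound_of_continuousOn (continuousOn_id.rpow_const
          fun x hx => Or.inl (by have := hx.1; simp only [id]; linarith))
      obtain ⟨K, hK⟩ := hc
      refine Integrable.mono' (hi.const_mul K) hmeas.aestronglyMeasurable ?_
      filter_upwards [ae_restrict_mem measurableSet_Ioc] with x hx
      have hx0 : 0 < x := lt_trans (by norm_num) hx.1
      have := hK x ⟨hx.1.le, hx.2⟩
      rw [Real.norm_of_nonneg (by positivity)] at this ⊢
      exact (mul_le_of_le_one_right (by positivity) (hle x)).trans (by gcongr)
  · have hi := (integrableOn_Ioi_rpow_of_lt hPb two_pos).const_mul ((1/2 : ℝ) ^ (-g))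
    refine Integrable.mono' hi hmeas.aestronglyMeasurable ?_
    filter_upwards [ae_restrict_mem measurableSet_Ioi] with x hx
    have hx2 : 2 < x := hx
    have hx0 : 0 < x := lt_trans two_pos hx
    rw [Real.norm_of_nonneg (by positivity)]
    have h1 : (1 + x ^ 2) ^ (-b) ≤ x ^ (-(2 * b)) := by
      rw [show x ^ (-(2 * b)) = (x ^ 2) ^ (-b) by
        rw [← rpow_natCast x 2, ← rpow_mul hx0.le]; congr 1; push_cast; ring]
      exact rpow_le_rpow_of_nonpos (by positivity) (by linarith) (by linarith)
    have h2 : |1 - x| ^ (-g) ≤ (1/2 : ℝ) ^ (-g) * x ^ (-g) := by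
      rw [← mul_rpow (by norm_num) hx0.le]
      refine rpow_le_rpow_of_nonpos (by positivity) ?_ (by linarith)
      rw [abs_of_neg (by linarith)]; linarith
    calc _ ≤ x ^ P * ((1/2 : ℝ) ^ (-g) * x ^ (-g)) * x ^ (-(2 * b)) := by gcongr
      _ = (1/2 : ℝ) ^ (-g) * (x ^ P * x ^ (-g) * x ^ (-(2 * b))) := by ring
      _ = _ := by
        rw [← rpow_add hx0, ← rpow_add hx0]; ring_nf

lemma xiSq_symm (r r' z z' : ℝ) : xiSq r r' z z' = xiSq r' r z' z := by
  unfold xiSq; rw [mul_comm r]; ring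

lemma xiSq_nonneg {r r' : ℝ} (hr : 0 < r) (hr' : 0 < r') (z z' : ℝ) : 0 ≤ xiSq r r' z z' := by
  unfold xiSq; positivity

lemma xiSq_pos {r r' z z' : ℝ} (hr : 0 < r) (hr' : 0 < r') (h : r' ≠ r ∨ z' ≠ z) :
    0 < xiSq r r' z z' := by
  unfold xiSq
  refine div_pos ?_ (by positivity)
  rcases h with h | h
  · have := sq_pos_of_ne_zero (sub_ne_zero.2 h.symm)
    positivity
  · have := sq_pos_of_ne_zero (sub_ne_zero.2 h.symm)
    positivity

lemma xiSq_eq {r r' : ℝ} (hr : 0 < r) (hr' : 0 < r') (z z' : ℝ) :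
    xiSq r r' z z' = ((1 - r' / r) ^ 2 + ((z' - z) / r) ^ 2) / (r' / r) := by
  unfold xiSq; field_simp; ring

lemma rpow_mul_one_add_rpow_le {ρ ζ g a b : ℝ} (hρ : 0 < ρ) (hρ1 : ρ ≠ 1) (hζ : ζ ≠ 0)
    (hg : 0 ≤ g) (ha : 0 ≤ a) (hb : 0 ≤ b) :
    (((1 - ρ) ^ 2 + ζ ^ 2) / ρ) ^ (-g) * (1 + ((1 - ρ) ^ 2 + ζ ^ 2) / ρ) ^ (-(a + b)) ≤
      2 ^ (a + b) * (ρ ^ (g + (a + b)) * |1 - ρ| ^ (-g) * (1 + ρ ^ 2) ^ (-a)) *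
        (|ζ| ^ (-g) * (1 + ζ ^ 2) ^ (-b)) := by
  have h1 : 0 < |1 - ρ| := abs_pos.2 (sub_ne_zero.2 hρ1.symm)
  have h2 : 0 < |ζ| := abs_pos.2 hζ
  set s := ((1 - ρ) ^ 2 + ζ ^ 2) / ρ with hs
  have hs1 : |1 - ρ| * |ζ| / ρ ≤ s := by
    rw [hs]
    gcongr
    rw [← sq_abs (1 - ρ), ← sq_abs ζ]
    nlinarith [sq_nonneg (|1 - ρ| - |ζ|), mul_pos h1 h2]
  have hs0 : 0 < s := lt_of_lt_of_le (by positivity) hs1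
  have hs2 : (1 + ρ ^ 2) / (2 * ρ) ≤ 1 + s := by
    rw [hs, div_le_iff₀ (by positivity)]
    have : (1 + ((1 - ρ) ^ 2 + ζ ^ 2) / ρ) * (2 * ρ) = 2 * (ρ + (1 - ρ) ^ 2 + ζ ^ 2) := by
      field_simp; ring
    rw [this]; nlinarith [sq_nonneg (1 - ρ), sq_nonneg ζ]
  have hs3 : (1 + ζ ^ 2) / (2 * ρ) ≤ 1 + s := by
    rw [hs, div_le_iff₀ (by positivity)]
    have : (1 + ((1 - ρ) ^ 2 + ζ ^ 2) / ρ) * (2 * ρ) = 2 * (ρ + (1 - ρ) ^ 2 + ζ ^ 2) := by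
      field_simp; ring
    rw [this]; nlinarith [sq_nonneg (1 - ρ), sq_nonneg ζ, sq_nonneg ρ]
  have b1 : s ^ (-g) ≤ |1 - ρ| ^ (-g) * |ζ| ^ (-g) * ρ ^ g := by
    refine (rpow_le_rpow_of_nonpos (by positivity) hs1 (by linarith)).trans_eq ?_
    rw [div_rpow (by positivity) hρ.le, mul_rpow h1.le h2.le, rpow_neg hρ.le, div_inv_eq_mul]
  have b2 : (1 + s) ^ (-a) ≤ (1 + ρ ^ 2) ^ (-a) * (2 ^ a * ρ ^ a) := by
    refine (rpow_le_rpow_of_nonpos (by positivity) hs2 (by linarith)).trans_eq ?_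
    rw [div_rpow (by positivity) (by positivity), rpow_neg (by positivity : 0 ≤ 2 * ρ),
      div_inv_eq_mul, mul_rpow two_pos.le hρ.le]
  have b3 : (1 + s) ^ (-b) ≤ (1 + ζ ^ 2) ^ (-b) * (2 ^ b * ρ ^ b) := by
    refine (rpow_le_rpow_of_nonpos (by positivity) hs3 (by linarith)).trans_eq ?_
    rw [div_rpow (by positivity) (by positivity), rpow_neg (by positivity : 0 ≤ 2 * ρ),
      div_inv_eq_mul, mul_rpow two_pos.le hρ.le]
  have e : (1 + s) ^ (-(a + b)) = (1 + s) ^ (-a) * (1 + s) ^ (-b) := by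
    rw [← rpow_add (by positivity)]; congr 1; ring
  rw [e]
  calc _ ≤ (|1 - ρ| ^ (-g) * |ζ| ^ (-g) * ρ ^ g) *
        (((1 + ρ ^ 2) ^ (-a) * (2 ^ a * ρ ^ a)) * ((1 + ζ ^ 2) ^ (-b) * (2 ^ b * ρ ^ b))) := by
        gcongr
    _ = _ := by
      rw [rpow_add two_pos, rpow_add hρ, rpow_add hρ]; ring

/-- The kernel `(r'/r)^{-E} ξ^{-2g} (1 + ξ²)^{-N}` has uniformly bounded hyperbolic integral. -/
lemma exists_hyperbolic_lintegral_le {g N E : ℝ} (hg : 0 < g) (hg1 : g < 1) (hN : 2 ≤ N)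
    (hE : -(N + g) < E) (hE' : E < N + g - 1) :
    ∃ M : ℝ≥0∞, M ≠ ∞ ∧ ∀ r : ℝ, 0 < r → ∀ z : ℝ,
      ∫⁻ r' in Ioi (0:ℝ), ∫⁻ z', ENNReal.ofReal ((r' / r) ^ (-E) *
        (xiSq r r' z z' ^ (-g) * (1 + xiSq r r' z z') ^ (-N)) * r' ^ (-2 : ℝ)) ≤ M := by
  set τ := (N + g + E) / 4
  set b := (1 - g) / 2 + τ
  set a := N - b
  set φ : ℝ → ℝ := fun ρ => ρ ^ (g + N - E - 2) * |1 - ρ| ^ (-g) * (1 + ρ ^ 2) ^ (-a)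
  set ψ : ℝ → ℝ := fun ζ => |ζ| ^ (-g) * (1 + ζ ^ 2) ^ (-b)
  have hφm : Measurable fun x => ENNReal.ofReal (φ x) := by fun_prop
  have hψm : Measurable fun x => ENNReal.ofReal (ψ x) := by fun_prop
  have ha : 0 ≤ a := by simp only [a, b, τ]; linarith
  have hb : 0 ≤ b := by simp only [b, τ]; linarith
  have hφ : IntegrableOn φ (Ioi 0) := integrableOn_rpow_mul_abs_one_sub hg hg1 ha
    (by linarith) (by simp only [a, b, τ]; linarith)
  have hψ : Integrable ψ := integrable_rpow_abs_mul hg hg1 (by simp only [b, τ]; linarith)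
  have hφ' : ∫⁻ x in Ioi (0:ℝ), ENNReal.ofReal (φ x) ≠ ∞ := hφ.lintegral_lt_top.ne
  have hψ' : ∫⁻ x, ENNReal.ofReal (ψ x) ≠ ∞ := hψ.lintegral_lt_top.ne
  refine ⟨ENNReal.ofReal (2 ^ N) * ((∫⁻ x in Ioi (0:ℝ), ENNReal.ofReal (φ x)) *
    ∫⁻ x, ENNReal.ofReal (ψ x)), by finiteness, fun r hr z => ?_⟩
  have hptw : ∀ r', 0 < r' → r' ≠ r → ∀ z', z' ≠ z →
      ENNReal.ofReal ((r' / r) ^ (-E) *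
        (xiSq r r' z z' ^ (-g) * (1 + xiSq r r' z z') ^ (-N)) * r' ^ (-2 : ℝ)) ≤
      ENNReal.ofReal (2 ^ N * r ^ (-2 : ℝ)) * ENNReal.ofReal (φ (r' / r)) *
        ENNReal.ofReal (ψ ((z' - z) / r)) := by
    intro r' hr' hne z' hne'
    have hρ : 0 < r' / r := by positivity
    rw [← ENNReal.ofReal_mul (by positivity), ← ENNReal.ofReal_mul (by positivity)]
    refine ENNReal.ofReal_le_ofReal ?_
    rw [xiSq_eq hr hr']
    have h := rpow_mul_one_add_rpow_le (ρ := r' / r) (ζ := (z' - z) / r) (a := a) (b := b) hρ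
      (by rwa [ne_eq, div_eq_one_iff_eq hr.ne']) (div_ne_zero (sub_ne_zero.2 hne') hr.ne')
      hg.le ha hb
    rw [show a + b = N by simp only [a]; ring] at h
    refine (mul_le_mul_of_nonneg_right (mul_le_mul_of_nonneg_left h (by positivity))
      (by positivity)).trans_eq ?_
    calc _ = 2 ^ N * r ^ (-2 : ℝ) * ((r' / r) ^ (g + N) * (r' / r) ^ (-E) * (r' / r) ^ (-2 : ℝ) *
            |1 - r' / r| ^ (-g) * (1 + (r' / r) ^ 2) ^ (-a)) * ψ ((z' - z) / r) := by
          have : r' ^ (-2 : ℝ) = r ^ (-2 : ℝ) * (r' / r) ^ (-2 : ℝ) := by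
            rw [← mul_rpow hr.le hρ.le]; congr 1; field_simp
          rw [this]; simp only [ψ]; ring
      _ = _ := by
          rw [← rpow_add hρ, ← rpow_add hρ]; simp only [φ]; congr 5
  calc _ ≤ ∫⁻ r' in Ioi (0:ℝ), ∫⁻ z', ENNReal.ofReal (2 ^ N * r ^ (-2 : ℝ)) *
          ENNReal.ofReal (φ (r' / r)) * ENNReal.ofReal (ψ ((z' - z) / r)) := by
        refine lintegral_mono_ae ?_
        filter_upwards [ae_restrict_mem measurableSet_Ioi,
          ae_restrict_of_ae (Measure.ae_ne volume r)] with r' hr' hne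
        refine lintegral_mono_ae ?_
        filter_upwards [Measure.ae_ne volume z] with z' hne'
        exact hptw r' hr' hne z' hne'
    _ = ENNReal.ofReal (2 ^ N * r ^ (-2 : ℝ)) *
          (ENNReal.ofReal r * ∫⁻ x in Ioi (0:ℝ), ENNReal.ofReal (φ x)) *
          (ENNReal.ofReal r * ∫⁻ x, ENNReal.ofReal (ψ x)) := by
        rw [← setLIntegral_Ioi_comp_div hφm hr, ← lintegral_comp_sub_div hψm hr z]
        have inner : ∀ r', ∫⁻ z', ENNReal.ofReal (2 ^ N * r ^ (-2 : ℝ)) *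
            ENNReal.ofReal (φ (r' / r)) * ENNReal.ofReal (ψ ((z' - z) / r)) =
            ENNReal.ofReal (2 ^ N * r ^ (-2 : ℝ)) * ENNReal.ofReal (φ (r' / r)) *
              ∫⁻ z', ENNReal.ofReal (ψ ((z' - z) / r)) := fun r' =>
          lintegral_const_mul _ (hψm.comp ((measurable_id.sub_const z).div_const r))
        simp_rw [inner]
        rw [lintegral_mul_const _ (by fun_prop), lintegral_const_mul _ (by fun_prop)]
    _ = ENNReal.ofReal (2 ^ N * r ^ (-2 : ℝ) * (r * r)) *
          ((∫⁻ x in Ioi (0:ℝ), ENNReal.ofReal (φ x)) * ∫⁻ x, ENNReal.ofReal (ψ x)) := by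
        rw [ENNReal.ofReal_mul (p := 2 ^ N * r ^ (-2 : ℝ)) (by positivity),
          ENNReal.ofReal_mul (p := r) hr.le]
        ring
    _ = _ := by
        congr 2
        rw [rpow_neg hr.le, rpow_two]; field_simp

/-- A Schur-type version of Young's inequality, for a kernel factored as `A^{1/p} B^{1-1/q}`. -/
lemma lintegral_rpow_lintegral_le {X Y : Type*} [MeasurableSpace X] [MeasurableSpace Y]
    {μ : Measure X} {ν : Measure Y} [SFinite μ] [SFinite ν] {p q : ℝ} (hq : 1 < q) (hqp : q < p)
    {A B : X → Y → ℝ≥0∞} (hA : Measurable (Function.uncurry A))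
    (hB : Measurable (Function.uncurry B)) {G : Y → ℝ≥0∞} (hG : Measurable G) {M₁ M₂ : ℝ≥0∞}
    (hM₁ : ∀ᵐ y ∂ν, ∫⁻ x, A x y ∂μ ≤ M₁) (hM₂ : ∀ᵐ x ∂μ, ∫⁻ y, B x y ∂ν ≤ M₂) :
    ∫⁻ x, (∫⁻ y, A x y ^ (1/p) * B x y ^ (1 - 1/q) * G y ∂ν) ^ p ∂μ ≤
      M₁ * M₂ ^ ((1 - 1/q) * p) * (∫⁻ y, G y ^ q ∂ν) ^ (p/q) := by
  have hq0 : 0 < q := by linarith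
  have hp0 : 0 < p := by linarith
  have h1q : 1/q < 1 := by rw [div_lt_one hq0]; exact hq
  have hpq : 1/p < 1/q := one_div_lt_one_div_of_lt hq0 hqp
  have hp1 : 0 < 1/p := by positivity
  set L := ∫⁻ y, G y ^ q ∂ν
  have hold : ∀ x, ∫⁻ y, A x y ^ (1/p) * B x y ^ (1 - 1/q) * G y ∂ν ≤
      (∫⁻ y, A x y * G y ^ q ∂ν) ^ (1/p) * (∫⁻ y, B x y ∂ν) ^ (1 - 1/q) * L ^ (1/q - 1/p) := by
    intro x
    have hAx : Measurable (A x) := hA.comp measurable_prodMk_left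
    have hBx : Measurable (B x) := hB.comp measurable_prodMk_left
    have h := ENNReal.lintegral_prod_norm_pow_le (μ := ν) (Finset.univ : Finset (Fin 3))
      (f := ![fun y => A x y * G y ^ q, fun y => B x y, fun y => G y ^ q])
      (p := ![1/p, 1 - 1/q, 1/q - 1/p])
      (by
        intro i _
        fin_cases i
        · exact (hAx.mul (hG.pow_const q)).aemeasurable
        · exact hBx.aemeasurable
        · exact (hG.pow_const q).aemeasurable)
      (by simp [Fin.sum_univ_three]; ring)
      (by
        intro i _
        fin_cases i
        · exact hp1.le
        · exact (sub_pos.2 h1q).le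
        · exact (sub_pos.2 hpq).le)
    simp only [Fin.prod_univ_three, Matrix.cons_val] at h
    refine le_trans (le_of_eq (lintegral_congr fun y => ?_)) h
    rw [ENNReal.mul_rpow_of_nonneg _ _ hp1.le]
    have e : (G y ^ q) ^ (1/p) * (G y ^ q) ^ (1/q - 1/p) = G y := by
      rw [← ENNReal.rpow_add_of_nonneg _ _ hp1.le (sub_pos.2 hpq).le, ← ENNReal.rpow_mul]
      have : q * (1/p + (1/q - 1/p)) = 1 := by field_simp; ring
      rw [this, ENNReal.rpow_one]
    calc _ = A x y ^ (1/p) * B x y ^ (1 - 1/q) * ((G y ^ q) ^ (1/p) * (G y ^ q) ^ (1/q - 1/p)) := by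
          rw [e]
      _ = _ := by ring
  calc _ ≤ ∫⁻ x, (∫⁻ y, A x y * G y ^ q ∂ν) * (M₂ ^ ((1 - 1/q) * p) * L ^ ((1/q - 1/p) * p)) ∂μ := by
        refine lintegral_mono_ae ?_
        filter_upwards [hM₂] with x hx
        refine (ENNReal.rpow_le_rpow (hold x) hp0.le).trans ?_
        rw [ENNReal.mul_rpow_of_nonneg _ _ hp0.le, ENNReal.mul_rpow_of_nonneg _ _ hp0.le,
          ← ENNReal.rpow_mul, ← ENNReal.rpow_mul, ← ENNReal.rpow_mul,
          show 1/p * p = 1 by field_simp, ENNReal.rpow_one, mul_assoc]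
        gcongr
    _ = (∫⁻ y, (∫⁻ x, A x y ∂μ) * G y ^ q ∂ν) * (M₂ ^ ((1 - 1/q) * p) * L ^ ((1/q - 1/p) * p)) := by
        rw [lintegral_mul_const, lintegral_lintegral_swap]
        · congr 1
          refine lintegral_congr fun y => lintegral_mul_const _ (hA.comp measurable_prodMk_right)
        · exact (hA.mul ((hG.pow_const q).comp measurable_snd)).aemeasurable
        · exact (hA.mul ((hG.pow_const q).comp measurable_snd)).lintegral_prod_right'
    _ ≤ (M₁ * L) * (M₂ ^ ((1 - 1/q) * p) * L ^ ((1/q - 1/p) * p)) := by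
        gcongr
        rw [← lintegral_const_mul _ (hG.pow_const q)]
        refine lintegral_mono_ae ?_
        filter_upwards [hM₁] with y hy
        gcongr
    _ = _ := by
        have : L ^ (p/q) = L * L ^ ((1/q - 1/p) * p) := by
          conv_rhs => enter [1]; rw [← ENNReal.rpow_one L]
          rw [← ENNReal.rpow_add_of_nonneg _ _ zero_le_one
            (mul_nonneg (sub_pos.2 hpq).le hp0.le)]
          congr 1; field_simp; ring
        rw [this]; ring

lemma ofReal_integral_integral_le (g : ℝ → ℝ → ℝ) :
    ENNReal.ofReal (∫ r in Ioi (0:ℝ), ∫ z, g r z) ≤ ∫⁻ r in Ioi (0:ℝ), ∫⁻ z, ‖g r z‖ₑ := by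
  refine le_trans ?_ ((enorm_integral_le_lintegral_enorm _).trans
    (lintegral_mono fun r => enorm_integral_le_lintegral_enorm _))
  exact Real.ofReal_le_enorm _

lemma TestFun.continuous {f : ℝ → ℝ → ℝ} (hf : TestFun f) : Continuous (Function.uncurry f) :=
  hf.1.continuous

lemma TestFun.lintegral_eq {f : ℝ → ℝ → ℝ} (hf : TestFun f) {q : ℝ} (hq : 0 < q) :
    ∫⁻ r in Ioi (0:ℝ), ∫⁻ z, ENNReal.ofReal (|f r z| ^ q * r) =
      ENNReal.ofReal (∫ r in Ioi (0:ℝ), ∫ z, |f r z| ^ q * r) := by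
  set h : ℝ × ℝ → ℝ := fun x => |Function.uncurry f x| ^ q * x.1 with hh
  have hc : Continuous h :=
    (hf.continuous.abs.rpow_const fun _ => Or.inr hq.le).mul continuous_fst
  have hs : HasCompactSupport h := hf.2.1.mono fun x hx => by
    rw [Function.mem_support] at hx ⊢
    contrapose! hx
    simp [hh, hx, hq.ne']
  set μ₀ : Measure (ℝ × ℝ) := (volume.restrict (Ioi (0:ℝ))).prod volume
  have hi : Integrable h μ₀ := hc.integrable_of_hasCompactSupport hs
  have h0 : 0 ≤ᵐ[μ₀] h := by
    have : ∀ᵐ x ∂μ₀, x.1 ∈ Ioi (0:ℝ) :=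
      Measure.quasiMeasurePreserving_fst.ae (ae_restrict_mem measurableSet_Ioi)
    filter_upwards [this] with x hx
    have hx0 : 0 < x.1 := hx
    simp only [hh, Pi.zero_apply]
    positivity
  have e1 := integral_prod h hi
  have e2 := ofReal_integral_eq_lintegral_ofReal hi h0
  rw [e1, lintegral_prod _ (by fun_prop)] at e2
  exact e2.symm

lemma schur_factorization {r r' k a t P Q : ℝ} (hr : 0 < r) (hr' : 0 < r') (hk : 0 ≤ k)
    (hP : 0 < P) (hQ : 0 < Q) (ht : 0 < t) (htPQ : t * P + t * Q = 1) :
    ((r / r') ^ ((a + Q) * t) * k ^ t * r ^ (-2 : ℝ)) ^ P *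
      ((r' / r) ^ (-((a - P) * t)) * k ^ t * r' ^ (-2 : ℝ)) ^ Q =
    r ^ (a - 2 * P) * (k * r' ^ (-a - 2 * Q)) := by
  have hk' : k ^ (t * P) * k ^ (t * Q) = k := by
    rw [← rpow_add_of_nonneg hk (by positivity) (by positivity), htPQ, rpow_one]
  have e1 : (r / r') ^ ((a + Q) * t) = r ^ ((a + Q) * t) * r' ^ (-((a + Q) * t)) := by
    rw [div_rpow hr.le hr'.le, rpow_neg hr'.le, div_eq_mul_inv]
  have e2 : (r' / r) ^ (-((a - P) * t)) = r ^ ((a - P) * t) * r' ^ (-((a - P) * t)) := by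
    rw [div_rpow hr'.le hr.le, rpow_neg hr.le, div_inv_eq_mul, mul_comm]
  rw [e1, e2, mul_rpow (by positivity) (by positivity), mul_rpow (by positivity) (by positivity),
    mul_rpow (by positivity) (by positivity), mul_rpow (by positivity) (by positivity),
    mul_rpow (by positivity) (by positivity), mul_rpow (by positivity) (by positivity)]
  simp only [← rpow_mul hr.le, ← rpow_mul hr'.le, ← rpow_mul hk]
  calc _ = (r ^ ((a + Q) * t * P) * r ^ (-2 * P) * r ^ ((a - P) * t * Q)) *
        ((k ^ (t * P) * k ^ (t * Q)) *
        (r' ^ (-((a + Q) * t) * P) * r' ^ (-((a - P) * t) * Q) * r' ^ (-2 * Q))) := by ring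
    _ = _ := by
      rw [hk', ← rpow_add hr, ← rpow_add hr, ← rpow_add hr', ← rpow_add hr']
      congr 2
      · linear_combination a * htPQ
      · congr 1
        linear_combination (-a) * htPQ

/-- The Schur kernel, for `x` ranging over the half plane based at `y`. -/
def schurKernel (g N E : ℝ) (y x : ℝ × ℝ) : ℝ :=
  (x.1 / y.1) ^ (-E) *
    (xiSq y.1 x.1 y.2 x.2 ^ (-g) * (1 + xiSq y.1 x.1 y.2 x.2) ^ (-N)) * x.1 ^ (-2 : ℝ)

lemma measurable_schurKernel (g N E : ℝ) :
    Measurable fun w : (ℝ × ℝ) × ℝ × ℝ => schurKernel g N E w.1 w.2 := by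
  unfold schurKernel xiSq; fun_prop

lemma measurable_decayKernel (γ r z : ℝ) :
    Measurable fun w : ℝ × ℝ => decayKernel γ (xiSq r w.1 z w.2) := by
  unfold decayKernel xiSq; fun_prop

/-- The measure `dr dz` on the half plane. -/
abbrev halfPlane : Measure (ℝ × ℝ) := (volume.restrict (Ioi (0:ℝ))).prod volume

lemma ae_halfPlane : ∀ᵐ x ∂halfPlane, 0 < x.1 :=
  Measure.quasiMeasurePreserving_fst.ae (ae_restrict_mem measurableSet_Ioi)

lemma exists_lintegral_schurKernel_le {g N E : ℝ} (hg : 0 < g) (hg1 : g < 1) (hN : 2 ≤ N)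
    (hE : -(N + g) < E) (hE' : E < N + g - 1) :
    ∃ M : ℝ≥0∞, M ≠ ∞ ∧ ∀ᵐ y ∂halfPlane,
      ∫⁻ x, ENNReal.ofReal (schurKernel g N E y x) ∂halfPlane ≤ M := by
  obtain ⟨M, hM, h⟩ := exists_hyperbolic_lintegral_le hg hg1 hN hE hE'
  refine ⟨M, hM, ?_⟩
  filter_upwards [ae_halfPlane] with y hy
  have hm : Measurable fun x => ENNReal.ofReal (schurKernel g N E y x) :=
    ((measurable_schurKernel g N E).comp measurable_prodMk_left).ennreal_ofReal
  rw [lintegral_prod _ hm.aemeasurable]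
  exact h y.1 hy y.2

/-- Weighted `L^q → L^p` bound for operators dominated by `decayKernel γ ξ²`. -/
lemma exists_cylLp_le_of_decayKernel {p q α β γ : ℝ} (hq1 : 1 < q) (hqp : q < p)
    (hα : -3 ≤ α + 1/p) (hβ : -2 ≤ β - 1/q) (hscal : 1/q = 1/p + (α + β)/3)
    (hγ : 0 < γ) (hγ1 : γ < 1 + 1/p - 1/q) :
    ∃ C : ℝ, 0 ≤ C ∧ ∀ (f u : ℝ → ℝ → ℝ) (D : ℝ), TestFun f → 0 ≤ D →
      (∀ r, 0 < r → ∀ z, ENNReal.ofReal |u r z| ≤ ENNReal.ofReal (D * r ^ (α - 1/2)) *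
        ∫⁻ w, ENNReal.ofReal (decayKernel γ (xiSq r w.1 z w.2) *
          (w.1 ^ (β - 3/2) * |f w.1 w.2|)) ∂halfPlane) →
      cylLp p u ≤ C * D * cylLp q f := by
  have hq0 : 0 < q := by linarith
  have hp0 : 0 < p := by linarith
  set P := 1/p with hPdef
  set Q := 1 - 1/q with hQdef
  have hP : 0 < P := by positivity
  have hQ : 0 < Q := by
    have : 1/q < 1 := by rw [div_lt_one hq0]; exact hq1
    simp only [hQdef]; linarith
  have hpq : P < 1/q := one_div_lt_one_div_of_lt hq0 hqp
  have hPQ1 : P + Q < 1 := by simp only [hQdef]; linarith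
  set t := (P + Q)⁻¹ with htdef
  have ht : 0 < t := by positivity
  have ht1 : 1 < t := (one_lt_inv₀ (by positivity)).2 hPQ1
  have htPQ : t * (P + Q) = 1 := inv_mul_cancel₀ (by positivity)
  set a := α + 3 * P - 1/2 with hadef
  have c1 : -(7/2) < a - P := by simp only [hadef]; linarith
  have c2 : a + Q < 7/2 := by
    have : 1/q < 1 := by linarith
    simp only [hadef, hQdef]; linarith
  have hg1 : γ * t < 1 := by
    rw [← htPQ, mul_comm]
    exact mul_lt_mul_of_pos_left (by simp only [hQdef]; linarith) ht
  have hN : 2 ≤ (7/2 - γ) * t := by nlinarith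
  have hNg : (7/2 - γ) * t + γ * t = 7/2 * t := by ring
  obtain ⟨M₁, hM₁, h₁⟩ := exists_lintegral_schurKernel_le (g := γ * t) (N := (7/2 - γ) * t)
    (E := -((a + Q) * t)) (by positivity) hg1 hN (by rw [hNg]; nlinarith)
    (by rw [hNg]; nlinarith)
  obtain ⟨M₂, hM₂, h₂⟩ := exists_lintegral_schurKernel_le (g := γ * t) (N := (7/2 - γ) * t)
    (E := (a - P) * t) (by positivity) hg1 hN (by rw [hNg]; nlinarith)
    (by rw [hNg]; nlinarith)
  set M : ℝ≥0∞ := M₁ * M₂ ^ (Q * p)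
  have hM : M ≠ ∞ := by
    have : 0 ≤ Q * p := by positivity
    finiteness
  refine ⟨(2 * π * M.toReal) ^ (1/p) * (2 * π) ^ (-(1/q)), by positivity,
    fun f u D hf hD hu => ?_⟩
  set G : ℝ × ℝ → ℝ≥0∞ := fun y => ENNReal.ofReal (|f y.1 y.2| * y.1 ^ (1/q))
  have hfm : Measurable fun y : ℝ × ℝ => f y.1 y.2 := hf.continuous.measurable
  have hG : Measurable G := by fun_prop
  have key := lintegral_rpow_lintegral_le (μ := halfPlane) (ν := halfPlane) hq1 hqp
    (A := fun x y => ENNReal.ofReal (schurKernel (γ * t) ((7/2 - γ) * t) (-((a + Q) * t)) y x))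
    (B := fun x y => ENNReal.ofReal (schurKernel (γ * t) ((7/2 - γ) * t) ((a - P) * t) x y))
    ((measurable_schurKernel _ _ _).comp measurable_swap).ennreal_ofReal
    (measurable_schurKernel _ _ _).ennreal_ofReal hG h₁ h₂
  set H : ℝ × ℝ → ℝ≥0∞ := fun x => ∫⁻ y,
    ENNReal.ofReal (schurKernel (γ * t) ((7/2 - γ) * t) (-((a + Q) * t)) y x) ^ (1/p) *
    ENNReal.ofReal (schurKernel (γ * t) ((7/2 - γ) * t) ((a - P) * t) x y) ^ (1 - 1/q) * G y
    ∂halfPlane with hH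
  have hGq : ∫⁻ y, G y ^ q ∂halfPlane =
      ENNReal.ofReal (∫ r in Ioi (0:ℝ), ∫ z, |f r z| ^ q * r) := by
    rw [← hf.lintegral_eq hq0, lintegral_prod _ (by fun_prop)]
    refine setLIntegral_congr_fun measurableSet_Ioi fun r hr => lintegral_congr fun z => ?_
    have hr0 : 0 < r := hr
    simp only [G]
    rw [ENNReal.ofReal_rpow_of_nonneg (by positivity) hq0.le,
      mul_rpow (by positivity) (by positivity), ← rpow_mul hr0.le, one_div_mul_cancel hq0.ne',
      rpow_one]
  have hHm : Measurable H := by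
    have : Measurable fun w : (ℝ × ℝ) × ℝ × ℝ =>
        ENNReal.ofReal (schurKernel (γ * t) ((7/2 - γ) * t) (-((a + Q) * t)) w.2 w.1) ^ (1/p) *
        ENNReal.ofReal (schurKernel (γ * t) ((7/2 - γ) * t) ((a - P) * t) w.1 w.2) ^ (1 - 1/q) *
        G w.2 :=
      ((((measurable_schurKernel _ _ _).comp measurable_swap).ennreal_ofReal.pow_const _).mul
        ((measurable_schurKernel _ _ _).ennreal_ofReal.pow_const _)).mul (hG.comp measurable_snd)
    exact this.lintegral_prod_right'
  have hptw : ∀ r, 0 < r → ∀ z, ENNReal.ofReal (|u r z| * r ^ (1/p)) ≤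
      ENNReal.ofReal D * H (r, z) := by
    intro r hr z
    have hr' : 0 ≤ r ^ (α - 1/2) := by positivity
    rw [ENNReal.ofReal_mul (by positivity)]
    refine (mul_le_mul_left (hu r hr z) _).trans_eq ?_
    rw [ENNReal.ofReal_mul hD, mul_assoc, mul_assoc, mul_comm (∫⁻ w, _ ∂_), ← mul_assoc,
      ← mul_assoc, mul_assoc (ENNReal.ofReal D), ← ENNReal.ofReal_mul hr', ← rpow_add hr, mul_assoc]
    congr 1
    have hm : Measurable fun w : ℝ × ℝ => ENNReal.ofReal (decayKernel γ (xiSq r w.1 z w.2) *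
          (w.1 ^ (β - 3/2) * |f w.1 w.2|)) := by
      have := measurable_decayKernel γ r z
      fun_prop
    rw [← lintegral_const_mul _ hm]
    refine lintegral_congr_ae ?_
    filter_upwards [ae_halfPlane] with y hy
    have hxi := xiSq_nonneg hr hy z y.2
    have hk := decayKernel_nonneg γ hxi
    have hkt : decayKernel γ (xiSq r y.1 z y.2) ^ t = xiSq r y.1 z y.2 ^ (-(γ * t)) *
        (1 + xiSq r y.1 z y.2) ^ (-((7/2 - γ) * t)) := by
      unfold decayKernel
      rw [mul_rpow (by positivity) (by positivity), ← rpow_mul hxi, ← rpow_mul (by positivity)]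
      ring_nf
    have hfac := schur_factorization (a := a) hr hy hk hP hQ ht (by rw [← htPQ]; ring)
    have h1 : ENNReal.ofReal (schurKernel (γ * t) ((7/2 - γ) * t) (-((a + Q) * t)) y (r, z)) ^
        (1/p) * ENNReal.ofReal (schurKernel (γ * t) ((7/2 - γ) * t) ((a - P) * t) (r, z) y) ^
        (1 - 1/q) = ENNReal.ofReal (r ^ (a - 2 * P) *
          (decayKernel γ (xiSq r y.1 z y.2) * y.1 ^ (-a - 2 * Q))) := by
      unfold schurKernel
      rw [xiSq_symm y.1 r, neg_neg, ← hkt, ENNReal.ofReal_rpow_of_nonneg (by positivity) hP.le,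
        ENNReal.ofReal_rpow_of_nonneg (by positivity) hQ.le, ← ENNReal.ofReal_mul (by positivity),
        hfac]
    have h2 : r ^ (α - 1/2 + 1/p) = r ^ (a - 2 * P) := by
      congr 1; simp only [hadef, hPdef]; ring
    have h3 : y.1 ^ (β - 3/2) = y.1 ^ (-a - 2 * Q) * y.1 ^ (1/q) := by
      rw [← rpow_add hy]; congr 1; simp only [hadef, hQdef]; linarith
    rw [h1, h2, ← ENNReal.ofReal_mul (by positivity), ← ENNReal.ofReal_mul (by positivity), h3]
    congr 1; ring
  set Pu := ∫ r in Ioi (0:ℝ), ∫ z, |u r z| ^ p * r with hPu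
  set Qf := ∫ r in Ioi (0:ℝ), ∫ z, |f r z| ^ q * r with hQf
  have hPu0 : 0 ≤ Pu := setIntegral_nonneg measurableSet_Ioi fun r hr =>
    integral_nonneg fun z => mul_nonneg (by positivity) (le_of_lt hr)
  have hQf0 : 0 ≤ Qf := setIntegral_nonneg measurableSet_Ioi fun r hr =>
    integral_nonneg fun z => mul_nonneg (by positivity) (le_of_lt hr)
  have main : ENNReal.ofReal Pu ≤ ENNReal.ofReal (D ^ p * (M.toReal * Qf ^ (p/q))) := by
    calc ENNReal.ofReal Pu ≤ ∫⁻ r in Ioi (0:ℝ), ∫⁻ z, ‖|u r z| ^ p * r‖ₑ :=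
          ofReal_integral_integral_le _
      _ ≤ ∫⁻ r in Ioi (0:ℝ), ∫⁻ z, ENNReal.ofReal D ^ p * H (r, z) ^ p := by
          refine setLIntegral_mono' measurableSet_Ioi fun r hr => lintegral_mono fun z => ?_
          have hr0 : 0 < r := hr
          rw [Real.enorm_of_nonneg (by positivity), ← ENNReal.mul_rpow_of_nonneg _ _ hp0.le]
          refine le_trans (le_of_eq ?_) (ENNReal.rpow_le_rpow (hptw r hr0 z) hp0.le)
          rw [ENNReal.ofReal_rpow_of_nonneg (by positivity) hp0.le,
            mul_rpow (by positivity) (by positivity), ← rpow_mul hr0.le,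
            one_div_mul_cancel hp0.ne', rpow_one]
      _ = ENNReal.ofReal D ^ p * ∫⁻ x, H x ^ p ∂halfPlane := by
          rw [← lintegral_const_mul _ (hHm.pow_const p),
            lintegral_prod _ ((hHm.pow_const p).const_mul _).aemeasurable]
      _ ≤ ENNReal.ofReal D ^ p * (M * ENNReal.ofReal Qf ^ (p/q)) := by
          rw [← hGq]; gcongr
      _ = _ := by
          rw [ENNReal.ofReal_mul (by positivity), ENNReal.ofReal_mul (by positivity),
            ENNReal.ofReal_toReal hM, ENNReal.ofReal_rpow_of_nonneg hD hp0.le,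
            ENNReal.ofReal_rpow_of_nonneg hQf0 (by positivity)]
  have main' : Pu ≤ D ^ p * (M.toReal * Qf ^ (p/q)) :=
    (ENNReal.ofReal_le_ofReal_iff (by positivity)).1 main
  unfold cylLp
  rw [← hPu, ← hQf]
  calc (2 * π * Pu) ^ (1/p) ≤ (2 * π * (D ^ p * (M.toReal * Qf ^ (p/q)))) ^ (1/p) := by gcongr
    _ = ((2 * π * M.toReal) * D ^ p * Qf ^ (p/q)) ^ (1/p) := by congr 1; ring
    _ = (2 * π * M.toReal) ^ (1/p) * D * Qf ^ (1/q) := by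
        rw [mul_rpow (by positivity) (by positivity), mul_rpow (by positivity) (by positivity),
          ← rpow_mul hD, mul_one_div_cancel hp0.ne', rpow_one, ← rpow_mul hQf0]
        congr 2; field_simp
    _ = (2 * π * M.toReal) ^ (1/p) * ((2 * π) ^ (-(1/q)) * (2 * π) ^ (1/q)) * D * Qf ^ (1/q) := by
        rw [← rpow_add (by positivity), neg_add_cancel, rpow_zero, mul_one]
    _ = _ := by
        rw [mul_rpow (by positivity) hQf0]; ring

lemma abs_le_of_xiSq {r r' : ℝ} (hr : 0 < r) (hr' : 0 < r') (z z' : ℝ) :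
    |(r' - r) / r| ≤ 2 * (√(xiSq r r' z z') + xiSq r r' z z') ∧
      |(z' - z) / r| ≤ 2 * (√(xiSq r r' z z') + xiSq r r' z z') := by
  set s := xiSq r r' z z' with hs
  have hs0 : 0 ≤ s := xiSq_nonneg hr hr' z z'
  set X := (r' - r) / r with hX
  set Z := (z' - z) / r with hZ
  have hρ : 0 < 1 + X := by
    have : 1 + X = r' / r := by simp only [hX]; field_simp; ring
    rw [this]; positivity
  have hsum : X ^ 2 + Z ^ 2 = (1 + X) * s := by
    simp only [hX, hZ, hs, xiSq]; field_simp; ring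
  have hρs : 1 + X ≤ s + 2 := by
    by_contra! h
    nlinarith [sq_nonneg Z]
  have hq : X ^ 2 + Z ^ 2 ≤ (2 * (√s + s)) ^ 2 := by
    have h1 := sq_sqrt hs0
    have h2 : 0 ≤ √s * s := by positivity
    nlinarith
  exact ⟨abs_le_of_sq_le_sq (by nlinarith) (by positivity),
    abs_le_of_sq_le_sq (by nlinarith) (by positivity)⟩

lemma hasDerivAt_xiSq_radial {r r' : ℝ} (hr : 0 < r) (hr' : 0 < r') (z z' : ℝ) :
    HasDerivAt (fun x => xiSq r x z z') ((2 * ((r' - r) / r) - xiSq r r' z z') / r') r' := by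
  unfold xiSq
  have h1 : HasDerivAt (fun x : ℝ => (r - x) ^ 2 + (z - z') ^ 2) (2 * (r - r') * -1) r' := by
    have := (((hasDerivAt_id r').const_sub r).pow 2).add_const ((z - z') ^ 2)
    simpa using this
  have h2 : HasDerivAt (fun x : ℝ => r * x) r r' := by
    simpa using (hasDerivAt_id r').const_mul r
  refine (h1.div h2 (by positivity)).congr_deriv ?_
  field_simp
  ring

lemma hasDerivAt_xiSq_axial (r r' z z' : ℝ) :
    HasDerivAt (fun x => xiSq r r' z x) (2 * (z' - z) / (r * r')) z' := by
  unfold xiSq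
  have h1 : HasDerivAt (fun x : ℝ => (r - r') ^ 2 + (z - x) ^ 2) (2 * (z - z') * -1) z' := by
    have := (((hasDerivAt_id z').const_sub z).pow 2).const_add ((r - r') ^ 2)
    simpa using this
  refine (h1.div_const (r * r')).congr_deriv ?_
  ring

lemma measurable_Fm (m : ℕ) : Measurable (Fm m) := by
  have h : StronglyMeasurable fun w : ℝ × ℝ => cos (m * w.2) / √(w.1 + 2 * (1 - cos w.2)) :=
    Measurable.stronglyMeasurable (by fun_prop)
  have h2 := (h.integral_prod_right' (ν := volume.restrict (Ioc 0 π))).measurable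
  convert h2 using 2 with s
  unfold Fm
  rw [intervalIntegral.integral_of_le pi_pos.le]

lemma ofReal_abs_integral_le {G H : ℝ → ℝ → ℝ} (a : ℝ)
    (hH : Measurable fun w : ℝ × ℝ => H w.1 w.2)
    (h : ∀ r, 0 < r → r ≠ a → ∀ z, |G r z| ≤ H r z) :
    ENNReal.ofReal |∫ r in Ioi (0:ℝ), ∫ z, G r z| ≤
      ∫⁻ w, ENNReal.ofReal (H w.1 w.2) ∂halfPlane := by
  rw [lintegral_prod _ hH.ennreal_ofReal.aemeasurable]
  have hna : ∀ᵐ r ∂volume.restrict (Ioi (0:ℝ)), r ≠ a :=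
    ae_restrict_of_ae (Measure.ae_ne volume a)
  calc ENNReal.ofReal |∫ r in Ioi (0:ℝ), ∫ z, G r z|
      = ‖∫ r in Ioi (0:ℝ), ∫ z, G r z‖ₑ := (Real.enorm_eq_ofReal_abs _).symm
    _ ≤ ∫⁻ r in Ioi (0:ℝ), ∫⁻ z, ‖G r z‖ₑ := (enorm_integral_le_lintegral_enorm _).trans
        (lintegral_mono fun r => enorm_integral_le_lintegral_enorm _)
    _ ≤ _ := by
        refine lintegral_mono_ae ?_
        filter_upwards [hna, ae_restrict_mem measurableSet_Ioi] with r hra hr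
        refine lintegral_mono fun z => ?_
        rw [Real.enorm_eq_ofReal_abs]
        exact ENNReal.ofReal_le_ofReal (h r hr hra z)

lemma ofReal_abs_integral_le' {G H : ℝ → ℝ → ℝ} (a : ℝ)
    (hH : Measurable fun w : ℝ × ℝ => H w.1 w.2)
    (h : ∀ z, z ≠ a → ∀ r, 0 < r → |G r z| ≤ H r z) :
    ENNReal.ofReal |∫ z, ∫ r in Ioi (0:ℝ), G r z| ≤
      ∫⁻ w, ENNReal.ofReal (H w.1 w.2) ∂halfPlane := by
  rw [lintegral_prod_symm _ hH.ennreal_ofReal.aemeasurable]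
  calc ENNReal.ofReal |∫ z, ∫ r in Ioi (0:ℝ), G r z|
      = ‖∫ z, ∫ r in Ioi (0:ℝ), G r z‖ₑ := (Real.enorm_eq_ofReal_abs _).symm
    _ ≤ ∫⁻ z, ∫⁻ r in Ioi (0:ℝ), ‖G r z‖ₑ := (enorm_integral_le_lintegral_enorm _).trans
        (lintegral_mono fun r => enorm_integral_le_lintegral_enorm _)
    _ ≤ _ := by
        refine lintegral_mono_ae ?_
        filter_upwards [Measure.ae_ne volume a] with z hza
        refine setLIntegral_mono' measurableSet_Ioi fun r hr => ?_
        rw [Real.enorm_eq_ofReal_abs]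
        exact ENNReal.ofReal_le_ofReal (h z hza r hr)

/-- Functions continuous on the half plane and supported in a compact subset of it are integrable
against the kernel of `Lminv`. -/
lemma integrable_Fm_xiSq_mul {m : ℕ} (hm : 3 ≤ m) {r : ℝ} (hr : 0 < r) (z : ℝ) {G : ℝ → ℝ → ℝ}
    {S : Set (ℝ × ℝ)} (hS : IsCompact S) (hS0 : S ⊆ Ioi (0:ℝ) ×ˢ univ)
    (hG : ContinuousOn (fun w : ℝ × ℝ => G w.1 w.2) (Ioi (0:ℝ) ×ˢ univ))
    (hGS : ∀ w ∉ S, G w.1 w.2 = 0) :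
    Integrable (fun w : ℝ × ℝ => Fm m (xiSq r w.1 z w.2) * G w.1 w.2) halfPlane := by
  obtain ⟨C, hC, hFC⟩ := exists_abs_cosKernel_half_le (θ := 0) (η := 1/2) (by norm_num)
    (by norm_num) le_rfl zero_le_one
  obtain ⟨M, hM, hMle⟩ := exists_hyperbolic_lintegral_le (g := 1/4) (N := 13/4) (E := 0)
    (by norm_num) (by norm_num) (by norm_num) (by norm_num) (by norm_num)
  have hbd : ContinuousOn (fun w : ℝ × ℝ => G w.1 w.2 * w.1 ^ 2) S :=
    (hG.mono hS0).mul (by fun_prop)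
  obtain ⟨B, hB⟩ := hS.exists_bound_of_continuousOn hbd
  have hB' : ∀ w : ℝ × ℝ, 0 < w.1 → |G w.1 w.2| ≤ |B| * w.1 ^ (-2 : ℝ) := by
    intro w hw
    by_cases hwS : w ∈ S
    · have h1 := (hB w hwS).trans (le_abs_self B)
      rw [Real.norm_eq_abs, abs_mul, abs_of_pos (pow_pos hw 2)] at h1
      rw [rpow_neg hw.le, ← div_eq_mul_inv, le_div_iff₀ (by positivity)]
      exact_mod_cast h1
    · rw [hGS w hwS, abs_zero]; positivity
  have hmeas : AEStronglyMeasurable (fun w : ℝ × ℝ => Fm m (xiSq r w.1 z w.2) * G w.1 w.2)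
      halfPlane := by
    refine AEStronglyMeasurable.mul ?_ ?_
    · refine Measurable.aestronglyMeasurable ((measurable_Fm m).comp ?_)
      unfold xiSq; fun_prop
    · have := hG.aestronglyMeasurable (μ := volume) (measurableSet_Ioi.prod MeasurableSet.univ)
      rwa [Measure.volume_eq_prod, ← Measure.prod_restrict, Measure.restrict_univ] at this
  set Φ : ℝ × ℝ → ℝ := fun w => C * |B| * ((w.1 / r) ^ (-0 : ℝ) *
    (xiSq r w.1 z w.2 ^ (-(1/4) : ℝ) * (1 + xiSq r w.1 z w.2) ^ (-(13/4) : ℝ)) * w.1 ^ (-2 : ℝ))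
  have hΦm : Measurable fun w : ℝ × ℝ => (w.1 / r) ^ (-0 : ℝ) *
    (xiSq r w.1 z w.2 ^ (-(1/4) : ℝ) * (1 + xiSq r w.1 z w.2) ^ (-(13/4) : ℝ)) *
      w.1 ^ (-2 : ℝ) := by
    unfold xiSq; fun_prop
  have hΦ : Integrable Φ halfPlane := by
    refine Integrable.const_mul ⟨hΦm.aestronglyMeasurable, ?_⟩ _
    have : ∫⁻ w : ℝ × ℝ, ‖(w.1 / r) ^ (-0 : ℝ) *
        (xiSq r w.1 z w.2 ^ (-(1/4) : ℝ) * (1 + xiSq r w.1 z w.2) ^ (-(13/4) : ℝ)) *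
        w.1 ^ (-2 : ℝ)‖ₑ ∂halfPlane ≤ M := by
      refine le_trans (le_of_eq ?_) (hMle r hr z)
      rw [← lintegral_prod (fun w : ℝ × ℝ => ENNReal.ofReal ((w.1 / r) ^ (-0 : ℝ) *
        (xiSq r w.1 z w.2 ^ (-(1/4) : ℝ) * (1 + xiSq r w.1 z w.2) ^ (-(13/4) : ℝ)) *
        w.1 ^ (-2 : ℝ))) hΦm.ennreal_ofReal.aemeasurable]
      refine lintegral_congr_ae ?_
      filter_upwards [ae_halfPlane] with w hw
      have := xiSq_nonneg hr hw z w.2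
      rw [Real.enorm_of_nonneg (by positivity)]
    exact this.trans_lt hM.lt_top
  have hne : ∀ᵐ w ∂halfPlane, w.1 ≠ r :=
    Measure.quasiMeasurePreserving_fst.ae (ae_restrict_of_ae (Measure.ae_ne volume r))
  refine hΦ.mono' hmeas ?_
  filter_upwards [ae_halfPlane, hne] with w hw hwr
  have hs := xiSq_pos hr hw (z := z) (z' := w.2) (Or.inl hwr)
  have h1 := hFC m hm _ hs
  rw [← Fm_eq_cosKernel m hs, neg_zero, rpow_zero, mul_one] at h1
  rw [Real.norm_eq_abs, abs_mul]
  refine (mul_le_mul h1 (hB' w hw) (abs_nonneg _)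
    (mul_nonneg hC.le (decayKernel_nonneg _ hs.le))).trans_eq ?_
  simp only [Φ, decayKernel]
  norm_num
  ring

lemma hasDerivAt_Fm (m : ℕ) {s : ℝ} (hs : 0 < s) :
    HasDerivAt (Fm m) (-(1/2) * cosKernel m (3/2) s) s := by
  have h := hasDerivAt_cosKernel m (ν := 1/2) (by norm_num) hs
  rw [show (1/2 + 1 : ℝ) = 3/2 by norm_num] at h
  refine h.congr_of_eventuallyEq ?_
  filter_upwards [eventually_gt_nhds hs] with x hx using Fm_eq_cosKernel m hx

lemma integral_Ioi_mul_eq_neg_of_isCompact {u u' v v' : ℝ → ℝ} {K : Set ℝ} (hK : IsCompact K)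
    (hK0 : K ⊆ Ioi 0) (hu : ∀ x ∈ Ioi (0:ℝ), HasDerivAt u (u' x) x)
    (hv : ∀ x ∈ Ioi (0:ℝ), HasDerivAt v (v' x) x) (hu' : ContinuousOn u' (Ioi 0))
    (hv' : ContinuousOn v' (Ioi 0)) (hvK : ∀ x ∉ K, v x = 0) (hvK' : ∀ x ∉ K, v' x = 0) :
    ∫ x in Ioi (0:ℝ), u x * v' x = -∫ x in Ioi (0:ℝ), u' x * v x := by
  have hi : ∀ h : ℝ → ℝ, ContinuousOn h (Ioi 0) → (∀ x ∉ K, h x = 0) →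
      IntegrableOn h (Ioi 0) := fun h hc h0 =>
    ((hc.mono hK0).integrableOn_compact hK).of_forall_sdiff_eq_zero measurableSet_Ioi
      fun x hx => h0 x hx.2
  have huc : ContinuousOn u (Ioi 0) := fun x hx => (hu x hx).continuousAt.continuousWithinAt
  have hvc : ContinuousOn v (Ioi 0) := fun x hx => (hv x hx).continuousAt.continuousWithinAt
  have h0 : ∀ᶠ x in nhds (0:ℝ), (u * v) x = 0 := by
    filter_upwards [hK.isClosed.isOpen_compl.mem_nhds fun h => lt_irrefl (0:ℝ) (hK0 h)] with x hx
    rw [Pi.mul_apply, hvK x hx, mul_zero]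
  have hinf : ∀ᶠ x in Filter.atTop, (u * v) x = 0 := by
    filter_upwards [atTop_le_cocompact hK.compl_mem_cocompact] with x hx
    rw [Pi.mul_apply, hvK x hx, mul_zero]
  rw [integral_Ioi_mul_deriv_eq_deriv_mul (a' := 0) (b' := 0) hu hv
    (hi _ (huc.mul hv') fun x hx => by rw [Pi.mul_apply, hvK' x hx, mul_zero])
    (hi _ (hu'.mul hvc) fun x hx => by rw [Pi.mul_apply, hvK x hx, mul_zero])
    (tendsto_const_nhds.congr' (Filter.EventuallyEq.symm (h0.filter_mono nhdsWithin_le_nhds)))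
    (tendsto_const_nhds.congr' (Filter.EventuallyEq.symm hinf))]
  ring

lemma integral_mul_eq_neg_of_isCompact {u u' v v' : ℝ → ℝ} {K : Set ℝ} (hK : IsCompact K)
    (hu : ∀ x, HasDerivAt u (u' x) x) (hv : ∀ x, HasDerivAt v (v' x) x) (hu' : Continuous u')
    (hv' : Continuous v') (hvK : ∀ x ∉ K, v x = 0) (hvK' : ∀ x ∉ K, v' x = 0) :
    ∫ x, u x * v' x = -∫ x, u' x * v x := by
  have hi : ∀ h : ℝ → ℝ, Continuous h → (∀ x ∉ K, h x = 0) → Integrable h := fun h hc h0 =>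
    hc.integrable_of_hasCompactSupport (HasCompactSupport.intro hK h0)
  have huc : Continuous u := continuous_iff_continuousAt.2 fun x => (hu x).continuousAt
  have hvc : Continuous v := continuous_iff_continuousAt.2 fun x => (hv x).continuousAt
  exact integral_mul_deriv_eq_deriv_mul_of_integrable (fun x _ => hu x) (fun x _ => hv x)
    (hi _ (huc.mul hv') fun x hx => by rw [Pi.mul_apply, hvK' x hx, mul_zero])
    (hi _ (hu'.mul hvc) fun x hx => by rw [Pi.mul_apply, hvK x hx, mul_zero])
    (hi _ (huc.mul hvc) fun x hx => by rw [Pi.mul_apply, hvK x hx, mul_zero])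

/-- The partial derivative in the first variable. -/
def radialDeriv (f : ℝ → ℝ → ℝ) (r z : ℝ) : ℝ := fderiv ℝ (Function.uncurry f) (r, z) (1, 0)

/-- The partial derivative in the second variable. -/
def axialDeriv (f : ℝ → ℝ → ℝ) (r z : ℝ) : ℝ := fderiv ℝ (Function.uncurry f) (r, z) (0, 1)

namespace TestFun

variable {f : ℝ → ℝ → ℝ}

lemma hasFDerivAt (hf : TestFun f) (w : ℝ × ℝ) :
    HasFDerivAt (Function.uncurry f) (fderiv ℝ (Function.uncurry f) w) w :=
  (hf.1.differentiable (by simp) w).hasFDerivAt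

lemma continuous_fderiv (hf : TestFun f) : Continuous (fderiv ℝ (Function.uncurry f)) :=
  hf.1.continuous_fderiv (by simp)

lemma continuous_radialDeriv (hf : TestFun f) :
    Continuous fun w : ℝ × ℝ => radialDeriv f w.1 w.2 :=
  hf.continuous_fderiv.clm_apply continuous_const

lemma continuous_axialDeriv (hf : TestFun f) :
    Continuous fun w : ℝ × ℝ => axialDeriv f w.1 w.2 :=
  hf.continuous_fderiv.clm_apply continuous_const

lemma hasDerivAt_radial (hf : TestFun f) (r z : ℝ) :
    HasDerivAt (fun x => f x z) (radialDeriv f r z) r := by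
  have h := (hf.hasFDerivAt (r, z)).comp_hasDerivAt r
    ((hasDerivAt_id r).prodMk (hasDerivAt_const r z))
  exact h

lemma hasDerivAt_axial (hf : TestFun f) (r z : ℝ) :
    HasDerivAt (fun x => f r x) (axialDeriv f r z) z := by
  have h := (hf.hasFDerivAt (r, z)).comp_hasDerivAt z
    ((hasDerivAt_const z r).prodMk (hasDerivAt_id z))
  exact h

lemma eq_zero {r z : ℝ} (h : (r, z) ∉ tsupport (Function.uncurry f)) : f r z = 0 :=
  image_eq_zero_of_notMem_tsupport (f := Function.uncurry f) h

lemma radialDeriv_eq_zero {r z : ℝ} (h : (r, z) ∉ tsupport (Function.uncurry f)) :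
    radialDeriv f r z = 0 := by
  rw [radialDeriv, fderiv_of_notMem_tsupport ℝ h, zero_apply]

lemma axialDeriv_eq_zero {r z : ℝ} (h : (r, z) ∉ tsupport (Function.uncurry f)) :
    axialDeriv f r z = 0 := by
  rw [axialDeriv, fderiv_of_notMem_tsupport ℝ h, zero_apply]

end TestFun

lemma hasDerivAt_Fm_xiSq_axial (m : ℕ) {r r' : ℝ} (hr : 0 < r) (hr' : 0 < r') (hne : r' ≠ r)
    (z z' : ℝ) :
    HasDerivAt (fun x => Fm m (xiSq r r' z x))
      (-(1/2) * cosKernel m (3/2) (xiSq r r' z z') * (2 * (z' - z) / (r * r'))) z' :=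
  (hasDerivAt_Fm m (xiSq_pos hr hr' (Or.inl hne))).comp z' (hasDerivAt_xiSq_axial r r' z z')

lemma hasDerivAt_Fm_xiSq_radial (m : ℕ) {r r' z z' : ℝ} (hr : 0 < r) (hr' : 0 < r')
    (hne : z' ≠ z) :
    HasDerivAt (fun x => Fm m (xiSq r x z z')) (-(1/2) * cosKernel m (3/2) (xiSq r r' z z') *
      ((2 * ((r' - r) / r) - xiSq r r' z z') / r')) r' :=
  HasDerivAt.comp (h₂ := Fm m) r' (hasDerivAt_Fm m (xiSq_pos hr hr' (Or.inr hne)))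
    (hasDerivAt_xiSq_radial hr hr' z z')

lemma integral_Fm_mul_axialDeriv (m : ℕ) {r r' : ℝ} (hr : 0 < r) (hr' : 0 < r') (hne : r' ≠ r)
    (z c : ℝ) {f : ℝ → ℝ → ℝ} (hf : TestFun f) :
    ∫ z', Fm m (xiSq r r' z z') * (c * axialDeriv f r' z') =
      -∫ z', -(1/2) * cosKernel m (3/2) (xiSq r r' z z') * (2 * (z' - z) / (r * r')) *
        (c * f r' z') := by
  have hK : IsCompact (Prod.snd '' tsupport (Function.uncurry f)) :=
    hf.2.1.isCompact.image continuous_snd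
  have hnot : ∀ x ∉ Prod.snd '' tsupport (Function.uncurry f),
      (r', x) ∉ tsupport (Function.uncurry f) := fun x hx h => hx ⟨_, h, rfl⟩
  refine integral_mul_eq_neg_of_isCompact hK
    (fun x => hasDerivAt_Fm_xiSq_axial m hr hr' hne z x)
    (fun x => (hf.hasDerivAt_axial r' x).const_mul c) ?_ ?_
    (fun x hx => by rw [TestFun.eq_zero (hnot x hx), mul_zero])
    (fun x hx => by rw [TestFun.axialDeriv_eq_zero (hnot x hx), mul_zero])
  · have h1 : Continuous fun x => cosKernel m (3/2) (xiSq r r' z x) := by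
      refine (continuousOn_cosKernel m (by norm_num)).comp_continuous ?_
        fun x => xiSq_pos hr hr' (Or.inl hne)
      unfold xiSq; fun_prop
    fun_prop
  · have := hf.continuous_axialDeriv
    have h2 : Continuous fun x => axialDeriv f r' x := this.comp (Continuous.prodMk_right r')
    fun_prop

lemma integral_Fm_mul_radialDeriv (m : ℕ) {r z z' : ℝ} (hr : 0 < r) (hne : z' ≠ z)
    (e b : ℝ) {f : ℝ → ℝ → ℝ} (hf : TestFun f) :
    ∫ r' in Ioi (0:ℝ), Fm m (xiSq r r' z z') * (r' ^ e * (b * r' ^ (b - 1) * f r' z' +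
        r' ^ b * radialDeriv f r' z')) =
      -∫ r' in Ioi (0:ℝ), (-(1/2) * cosKernel m (3/2) (xiSq r r' z z') *
        ((2 * ((r' - r) / r) - xiSq r r' z z') / r') * r' ^ e +
        Fm m (xiSq r r' z z') * (e * r' ^ (e - 1))) * (r' ^ b * f r' z') := by
  have hK : IsCompact (Prod.fst '' tsupport (Function.uncurry f)) :=
    hf.2.1.isCompact.image continuous_fst
  have hK0 : Prod.fst '' tsupport (Function.uncurry f) ⊆ Ioi 0 := by
    rintro _ ⟨w, hw, rfl⟩
    exact (hf.2.2 hw).1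
  have hnot : ∀ x ∉ Prod.fst '' tsupport (Function.uncurry f),
      (x, z') ∉ tsupport (Function.uncurry f) := fun x hx h => hx ⟨_, h, rfl⟩
  have hpow : ∀ a : ℝ, ContinuousOn (fun x : ℝ => x ^ a) (Ioi 0) := fun a x hx =>
    (continuousAt_rpow_const x a (Or.inl (ne_of_gt hx))).continuousWithinAt
  have hpd : ∀ a : ℝ, ∀ x ∈ Ioi (0:ℝ), HasDerivAt (fun x : ℝ => x ^ a) (a * x ^ (a - 1)) x :=
    fun a x hx => Real.hasDerivAt_rpow_const (Or.inl (ne_of_gt hx))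
  have hxi : ContinuousOn (fun x => xiSq r x z z') (Ioi 0) := fun x hx =>
    (hasDerivAt_xiSq_radial hr hx z z').continuousAt.continuousWithinAt
  have hF : ContinuousOn (fun x => Fm m (xiSq r x z z')) (Ioi 0) := fun x hx =>
    (hasDerivAt_Fm_xiSq_radial m hr hx hne).continuousAt.continuousWithinAt
  have hk : ContinuousOn (fun x => cosKernel m (3/2) (xiSq r x z z')) (Ioi 0) :=
    (continuousOn_cosKernel m (by norm_num)).comp hxi fun x hx => xiSq_pos hr hx (Or.inr hne)
  have hfc : Continuous fun x => f x z' := hf.continuous.comp (Continuous.prodMk_left z')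
  have hfr : Continuous fun x => radialDeriv f x z' :=
    hf.continuous_radialDeriv.comp (Continuous.prodMk_left z')
  have key := integral_Ioi_mul_eq_neg_of_isCompact hK hK0
    (fun x hx => (hasDerivAt_Fm_xiSq_radial m hr hx hne).mul (hpd e x hx))
    (fun x hx => (hpd b x hx).mul (hf.hasDerivAt_radial x z')) ?_ ?_
    (fun x hx => by simp [TestFun.eq_zero (hnot x hx)])
    (fun x hx => by simp [TestFun.eq_zero (hnot x hx), TestFun.radialDeriv_eq_zero (hnot x hx)])
  · refine Eq.trans ?_ key
    refine integral_congr_ae (Filter.Eventually.of_forall fun x => ?_)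
    simp only [Pi.mul_apply]
    ring
  · refine (((continuousOn_const.mul hk).mul ((((continuousOn_const.mul
      ((continuousOn_id.sub continuousOn_const).div_const r)).sub hxi)).div continuousOn_id
        fun x hx => ne_of_gt hx)).mul (hpow e)).add (hF.mul (continuousOn_const.mul (hpow (e - 1))))
  · exact ((continuousOn_const.mul (hpow (b - 1))).mul hfc.continuousOn).add
      ((hpow b).mul hfr.continuousOn)

lemma integral_Fm_mul_radialDeriv_swap {m : ℕ} (hm : 3 ≤ m) {r : ℝ} (hr : 0 < r) (z e b : ℝ)
    {f : ℝ → ℝ → ℝ} (hf : TestFun f) :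
    ∫ r' in Ioi (0:ℝ), ∫ z', Fm m (xiSq r r' z z') * (r' ^ e * (b * r' ^ (b - 1) * f r' z' +
        r' ^ b * radialDeriv f r' z')) =
      -∫ z', ∫ r' in Ioi (0:ℝ), (-(1/2) * cosKernel m (3/2) (xiSq r r' z z') *
        ((2 * ((r' - r) / r) - xiSq r r' z z') / r') * r' ^ e +
        Fm m (xiSq r r' z z') * (e * r' ^ (e - 1))) * (r' ^ b * f r' z') := by
  have hpow : ∀ a : ℝ, ContinuousOn (fun w : ℝ × ℝ => w.1 ^ a) (Ioi 0 ×ˢ univ) := fun a =>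
    continuousOn_fst.rpow_const fun w hw => Or.inl (ne_of_gt hw.1)
  have hi := integrable_Fm_xiSq_mul hm hr z (G := fun r' z' => r' ^ e * (b * r' ^ (b - 1) *
    f r' z' + r' ^ b * radialDeriv f r' z')) hf.2.1.isCompact hf.2.2
    ((hpow e).mul (((continuousOn_const.mul (hpow (b - 1))).mul hf.continuous.continuousOn).add
      ((hpow b).mul hf.continuous_radialDeriv.continuousOn)))
    (fun w hw => by simp [TestFun.eq_zero hw, TestFun.radialDeriv_eq_zero hw])
  rw [integral_integral_swap hi, ← integral_neg]
  refine integral_congr_ae ?_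
  filter_upwards [Measure.ae_ne volume z] with z' hz'
  exact integral_Fm_mul_radialDeriv m hr hz' e b hf

lemma sqrt_div_eq_rpow {r r' : ℝ} (hr : 0 < r) (hr' : 0 < r') :
    √(r' / r) = r ^ (-(1/2) : ℝ) * r' ^ (1/2 : ℝ) := by
  rw [sqrt_div hr'.le, sqrt_eq_rpow, sqrt_eq_rpow, rpow_neg hr.le]
  field_simp

/-- The integrand dominating `L_m^{-1}` and its first order variants. -/
def majorant (β γ : ℝ) (f : ℝ → ℝ → ℝ) (r z r' z' : ℝ) : ℝ :=
  decayKernel γ (xiSq r r' z z') * (r' ^ (β - 3/2) * |f r' z'|)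

lemma measurable_majorant (β γ r z : ℝ) {f : ℝ → ℝ → ℝ} (hf : TestFun f) :
    Measurable fun w : ℝ × ℝ => majorant β γ f r z w.1 w.2 := by
  have h1 := measurable_decayKernel γ r z
  have h2 : Measurable fun w : ℝ × ℝ => f w.1 w.2 := hf.continuous.measurable
  unfold majorant
  fun_prop

lemma lintegral_const_mul_majorant (β γ r z : ℝ) {f : ℝ → ℝ → ℝ} (hf : TestFun f) {A : ℝ}
    (hA : 0 ≤ A) :
    ∫⁻ w, ENNReal.ofReal (A * majorant β γ f r z w.1 w.2) ∂halfPlane =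
      ENNReal.ofReal A * ∫⁻ w, ENNReal.ofReal (majorant β γ f r z w.1 w.2) ∂halfPlane := by
  rw [← lintegral_const_mul _ (measurable_majorant β γ r z hf).ennreal_ofReal]
  exact lintegral_congr fun w => ENNReal.ofReal_mul hA

section Bounds

variable {m : ℕ} {A β γ r : ℝ} {f : ℝ → ℝ → ℝ}

lemma ofReal_abs_rpow_mul_Lminv_le (hr : 0 < r) (z α : ℝ) {g : ℝ → ℝ → ℝ}
    (h : ENNReal.ofReal |∫ r' in Ioi (0:ℝ), ∫ z', Fm m (xiSq r r' z z') * g r' z' * √(r' / r)| ≤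
      ENNReal.ofReal (A * r ^ (-(1/2) : ℝ)) *
        ∫⁻ w, ENNReal.ofReal (majorant β γ f r z w.1 w.2) ∂halfPlane) :
    ENNReal.ofReal |r ^ α * Lminv m g r z| ≤ ENNReal.ofReal (A * r ^ (α - 1/2)) *
      ∫⁻ w, ENNReal.ofReal (majorant β γ f r z w.1 w.2) ∂halfPlane := by
  set I := ∫ r' in Ioi (0:ℝ), ∫ z', Fm m (xiSq r r' z z') * g r' z' * √(r' / r)
  have h2π : 1 / (2 * π) ≤ 1 := by
    rw [div_le_one (by positivity)]
    linarith [pi_gt_three]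
  have h1 : |r ^ α * Lminv m g r z| ≤ r ^ α * |I| := by
    rw [Lminv, abs_mul, abs_mul, abs_of_pos (rpow_pos_of_pos hr α),
      abs_of_pos (by positivity : 0 < 1 / (2 * π))]
    exact mul_le_mul_of_nonneg_left (mul_le_of_le_one_left (abs_nonneg _) h2π) (by positivity)
  refine (ENNReal.ofReal_le_ofReal h1).trans ?_
  rw [ENNReal.ofReal_mul (by positivity)]
  refine (mul_le_mul_right h _).trans_eq ?_
  rw [← mul_assoc, ← ENNReal.ofReal_mul (by positivity), sub_eq_add_neg, rpow_add hr]
  ring_nf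

lemma ofReal_abs_rpow_mul_Lminv_zeroth_le (hA : 0 ≤ A)
    (hK : ∀ s, 0 < s → |cosKernel m (1/2) s| ≤ A * decayKernel γ s)
    (hr : 0 < r) (z α : ℝ) (hf : TestFun f) :
    ENNReal.ofReal |r ^ α * Lminv m (fun r' z' => r' ^ (β - 2) * f r' z') r z| ≤
      ENNReal.ofReal (A * r ^ (α - 1/2)) *
        ∫⁻ w, ENNReal.ofReal (majorant β γ f r z w.1 w.2) ∂halfPlane := by
  refine ofReal_abs_rpow_mul_Lminv_le hr z α ?_
  rw [← lintegral_const_mul_majorant β γ r z hf (by positivity)]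
  refine ofReal_abs_integral_le
    (H := fun x y => A * r ^ (-(1/2) : ℝ) * majorant β γ f r z x y) r ((measurable_majorant β γ r z hf).const_mul _) ?_
  intro r' hr' hne z'
  have hs := xiSq_pos hr hr' (z := z) (z' := z') (Or.inl hne)
  have h1 := hK _ hs
  rw [← Fm_eq_cosKernel m hs] at h1
  have hpow : r' ^ (β - 3/2) = r' ^ (β - 2) * r' ^ (1/2 : ℝ) := by
    rw [← rpow_add hr']; ring_nf
  rw [sqrt_div_eq_rpow hr hr', majorant, hpow, abs_mul, abs_mul, abs_mul,
    abs_of_pos (by positivity : 0 < r ^ (-(1/2) : ℝ) * r' ^ (1/2 : ℝ)),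
    abs_of_pos (by positivity : 0 < r' ^ (β - 2))]
  calc _ ≤ A * decayKernel γ (xiSq r r' z z') * (r' ^ (β - 2) * |f r' z'|) *
        (r ^ (-(1/2) : ℝ) * r' ^ (1/2 : ℝ)) := by gcongr
    _ = _ := by ring

lemma ofReal_abs_integral_axial_le (hA : 0 ≤ A)
    (hK' : ∀ s, 0 < s → (√s + s) * |cosKernel m (3/2) s| ≤ A * decayKernel γ s)
    (hr : 0 < r) (z : ℝ) (hf : TestFun f) {g : ℝ → ℝ → ℝ}
    (hg : ∀ r', 0 < r' → ∀ z', g r' z' * √(r' / r) =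
      r ^ (-(1/2) : ℝ) * r' ^ (β - 1/2) * axialDeriv f r' z') :
    ENNReal.ofReal |∫ r' in Ioi (0:ℝ), ∫ z', Fm m (xiSq r r' z z') * g r' z' * √(r' / r)| ≤
      ENNReal.ofReal (3 * A * r ^ (-(1/2) : ℝ)) *
        ∫⁻ w, ENNReal.ofReal (majorant β γ f r z w.1 w.2) ∂halfPlane := by
  set U : ℝ → ℝ → ℝ := fun r' z' => -(-(1/2) * cosKernel m (3/2) (xiSq r r' z z') *
    (2 * (z' - z) / (r * r')) * (r ^ (-(1/2) : ℝ) * r' ^ (β - 1/2) * f r' z')) with hU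
  have heq : ∫ r' in Ioi (0:ℝ), ∫ z', Fm m (xiSq r r' z z') * g r' z' * √(r' / r) =
      ∫ r' in Ioi (0:ℝ), ∫ z', U r' z' := by
    refine setIntegral_congr_ae measurableSet_Ioi ?_
    filter_upwards [Measure.ae_ne volume r] with r' hne hr'
    simp only [mul_assoc (Fm m _), hg r' hr', hU, integral_neg]
    exact integral_Fm_mul_axialDeriv m hr hr' hne z _ hf
  rw [heq, ← lintegral_const_mul_majorant β γ r z hf (by positivity)]
  refine ofReal_abs_integral_le
    (H := fun x y => 3 * A * r ^ (-(1/2) : ℝ) * majorant β γ f r z x y) r ((measurable_majorant β γ r z hf).const_mul _) ?_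
  intro r' hr' hne z'
  have hs := xiSq_pos hr hr' (z := z) (z' := z') (Or.inl hne)
  have h1 := hK' _ hs
  have h2 := (abs_le_of_xiSq hr hr' z z').2
  have hpow : r' ^ (β - 3/2) = r' ^ (β - 1/2) / r' := by
    rw [← rpow_sub_one hr'.ne']; ring_nf
  have hUeq : U r' z' = cosKernel m (3/2) (xiSq r r' z z') * ((z' - z) / r) *
      (r ^ (-(1/2) : ℝ) * (r' ^ (β - 3/2) * f r' z')) := by
    simp only [hU, hpow]; field_simp
  rw [hUeq, majorant, abs_mul, abs_mul, abs_mul, abs_mul,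
    abs_of_pos (by positivity : 0 < r ^ (-(1/2) : ℝ)),
    abs_of_pos (by positivity : 0 < r' ^ (β - 3/2))]
  have h3 : |cosKernel m (3/2) (xiSq r r' z z')| * |(z' - z) / r| ≤
      3 * (A * decayKernel γ (xiSq r r' z z')) := by
    nlinarith [mul_le_mul_of_nonneg_left h2 (abs_nonneg (cosKernel m (3/2) (xiSq r r' z z'))),
      mul_nonneg hA (decayKernel_nonneg γ hs.le)]
  calc _ ≤ 3 * (A * decayKernel γ (xiSq r r' z z')) *
        (r ^ (-(1/2) : ℝ) * (r' ^ (β - 3/2) * |f r' z'|)) := by gcongr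
    _ = _ := by ring

lemma ofReal_abs_integral_radial_le (hm : 3 ≤ m) (hA : 0 ≤ A)
    (hK : ∀ s, 0 < s → |cosKernel m (1/2) s| ≤ A * decayKernel γ s)
    (hK' : ∀ s, 0 < s → (√s + s) * |cosKernel m (3/2) s| ≤ A * decayKernel γ s)
    (hr : 0 < r) (z : ℝ) (hf : TestFun f) {g : ℝ → ℝ → ℝ} {e b : ℝ} (he : |e| ≤ 1/2)
    (heb : e + b = β - 1/2)
    (hg : ∀ r', 0 < r' → ∀ z', g r' z' * √(r' / r) = r ^ (-(1/2) : ℝ) *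
      (r' ^ e * (b * r' ^ (b - 1) * f r' z' + r' ^ b * radialDeriv f r' z'))) :
    ENNReal.ofReal |∫ r' in Ioi (0:ℝ), ∫ z', Fm m (xiSq r r' z z') * g r' z' * √(r' / r)| ≤
      ENNReal.ofReal (3 * A * r ^ (-(1/2) : ℝ)) *
        ∫⁻ w, ENNReal.ofReal (majorant β γ f r z w.1 w.2) ∂halfPlane := by
  set U : ℝ → ℝ → ℝ := fun r' z' => (-(1/2) * cosKernel m (3/2) (xiSq r r' z z') *
        ((2 * ((r' - r) / r) - xiSq r r' z z') / r') * r' ^ e +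
        Fm m (xiSq r r' z z') * (e * r' ^ (e - 1))) * (r' ^ b * f r' z') with hU
  have heq : ∫ r' in Ioi (0:ℝ), ∫ z', Fm m (xiSq r r' z z') * g r' z' * √(r' / r) =
      r ^ (-(1/2) : ℝ) * -∫ z', ∫ r' in Ioi (0:ℝ), U r' z' := by
    rw [← integral_Fm_mul_radialDeriv_swap hm hr z e b hf, ← integral_const_mul]
    refine setIntegral_congr_fun measurableSet_Ioi fun r' hr' => ?_
    rw [← integral_const_mul]
    refine integral_congr_ae (Filter.Eventually.of_forall fun z' => ?_)
    simp only [mul_assoc (Fm m _), hg r' hr']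
    ring
  have hbd : ENNReal.ofReal |∫ z', ∫ r' in Ioi (0:ℝ), U r' z'| ≤ ENNReal.ofReal (3 * A) *
        ∫⁻ w, ENNReal.ofReal (majorant β γ f r z w.1 w.2) ∂halfPlane := by
    rw [← lintegral_const_mul_majorant β γ r z hf (by positivity)]
    refine ofReal_abs_integral_le' (H := fun x y => 3 * A * majorant β γ f r z x y) z ((measurable_majorant β γ r z hf).const_mul _) ?_
    intro z' hne r' hr'
    have hs := xiSq_pos hr hr' (z := z) (z' := z') (Or.inr hne)
    have h0 := hK _ hs
    rw [← Fm_eq_cosKernel m hs] at h0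
    have h1 := hK' _ hs
    have h2 := (abs_le_of_xiSq hr hr' z z').1
    set s := xiSq r r' z z'
    set k := A * decayKernel γ s with hk
    have hk0 : 0 ≤ k := mul_nonneg hA (decayKernel_nonneg γ hs.le)
    have hpow : r' ^ (β - 3/2) = r' ^ e * r' ^ b / r' := by
      rw [← rpow_add hr', ← rpow_sub_one hr'.ne']; congr 1; linarith
    have hUeq : U r' z' = (-(1/2) * (cosKernel m (3/2) s * (2 * ((r' - r) / r) - s)) +
        e * Fm m s) * (r' ^ (β - 3/2) * f r' z') := by
      simp only [hU, hpow, rpow_sub_one hr'.ne']; field_simp; ring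
    have h3 : |2 * ((r' - r) / r) - s| ≤ 5 * (√s + s) := by
      have h4 := sqrt_nonneg s
      rw [abs_le] at h2 ⊢
      constructor <;> linarith [h2.1, h2.2]
    have h5 : |-(1/2) * (cosKernel m (3/2) s * (2 * ((r' - r) / r) - s)) + e * Fm m s| ≤
        3 * k := by
      refine (abs_add_le _ _).trans ?_
      rw [abs_mul, abs_mul, abs_mul, abs_neg, abs_of_pos (by norm_num : (0:ℝ) < 1/2)]
      have h6 := mul_le_mul_of_nonneg_left h3 (abs_nonneg (cosKernel m (3/2) s))
      have h7 := mul_le_mul he h0 (abs_nonneg _) (by norm_num)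
      nlinarith
    rw [hUeq, majorant, abs_mul, abs_mul, abs_of_pos (by positivity : 0 < r' ^ (β - 3/2))]
    calc _ ≤ 3 * k * (r' ^ (β - 3/2) * |f r' z'|) := by gcongr
      _ = _ := by simp only [hk]; ring
  rw [heq, abs_mul, abs_neg, abs_of_pos (by positivity : 0 < r ^ (-(1/2) : ℝ)),
    ENNReal.ofReal_mul (by positivity)]
  refine (mul_le_mul_right hbd _).trans_eq ?_
  rw [← mul_assoc, ← ENNReal.ofReal_mul (by positivity), mul_comm (r ^ _)]

end Bounds

lemma hasDerivAt_rpow_mul_radial {f : ℝ → ℝ → ℝ} (hf : TestFun f) (b : ℝ) {r : ℝ} (hr : 0 < r)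
    (z : ℝ) : HasDerivAt (fun s => s ^ b * f s z)
      (b * r ^ (b - 1) * f r z + r ^ b * radialDeriv f r z) r :=
  (Real.hasDerivAt_rpow_const (Or.inl hr.ne')).mul (hf.hasDerivAt_radial r z)

lemma cylLp_nonneg (p : ℝ) (f : ℝ → ℝ → ℝ) : 0 ≤ cylLp p f := by
  refine rpow_nonneg (mul_nonneg (by positivity) ?_) _
  exact setIntegral_nonneg measurableSet_Ioi fun r hr =>
    integral_nonneg fun z => mul_nonneg (by positivity) (le_of_lt hr)

lemma exists_cylLp_Lminv_le {p q α β ε : ℝ} (hq1 : 1 < q) (hqp : q < p)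
    (hα : -3 ≤ α + 1/p) (hβ : -2 ≤ β - 1/q) (hscal : 1/q = 1/p + (α + β)/3)
    (hε : 0 < ε) (hε1 : ε < 1 + 1/p - 1/q) :
    ∃ C : ℝ, 0 < C ∧ ∀ m : ℕ, 3 ≤ m → ∀ f : ℝ → ℝ → ℝ, TestFun f →
      cylLp p (fun r z => r ^ α * Lminv m (fun r' z' => r' ^ (β - 2) * f r' z') r z)
        ≤ C * (m : ℝ) ^ (-(1 + 1/p - 1/q - ε)) * cylLp q f := by
  have hpq : 1/p < 1/q := one_div_lt_one_div_of_lt (by linarith) hqp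
  obtain ⟨C₀, hC₀, h₀⟩ := exists_cylLp_le_of_decayKernel (γ := 1 + 1/p - 1/q - ε + ε/2) hq1 hqp
    hα hβ hscal (by linarith) (by linarith)
  obtain ⟨C₁, hC₁, h₁⟩ := exists_abs_cosKernel_half_le (θ := 1 + 1/p - 1/q - ε) hε
    (by linarith) (by linarith) (by linarith)
  refine ⟨C₀ * C₁ + 1, by positivity, fun m hm f hf => ?_⟩
  have h := h₀ f _ (C₁ * (m:ℝ) ^ (-(1 + 1/p - 1/q - ε))) hf (by positivity) fun r hr z =>
    ofReal_abs_rpow_mul_Lminv_zeroth_le (by positivity) (h₁ m hm) hr z α hf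
  have hm0 : 0 ≤ (m:ℝ) ^ (-(1 + 1/p - 1/q - ε)) * cylLp q f :=
    mul_nonneg (by positivity) (cylLp_nonneg q f)
  linarith

lemma exists_cylLp_Lminv_deriv_le {p q α β ε : ℝ} (hq1 : 1 < q) (hqp : q < p)
    (hα : -3 ≤ α + 1/p) (hβ : -2 ≤ β - 1/q) (hscal : 1/q = 1/p + (α + β)/3)
    (hε : 0 < ε) (hε1 : ε < 1/2 + 1/p - 1/q) :
    ∃ C : ℝ, 0 < C ∧ ∀ m : ℕ, 3 ≤ m → ∀ f g : ℝ → ℝ → ℝ, TestFun f →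
      ((∃ e b : ℝ, |e| ≤ 1/2 ∧ e + b = β - 1/2 ∧ ∀ r, 0 < r → ∀ r', 0 < r' → ∀ z',
          g r' z' * √(r' / r) = r ^ (-(1/2) : ℝ) *
            (r' ^ e * (b * r' ^ (b - 1) * f r' z' + r' ^ b * radialDeriv f r' z'))) ∨
        ∀ r, 0 < r → ∀ r', 0 < r' → ∀ z', g r' z' * √(r' / r) =
          r ^ (-(1/2) : ℝ) * r' ^ (β - 1/2) * axialDeriv f r' z') →
      cylLp p (fun r z => r ^ α * Lminv m g r z)
        ≤ C * (m : ℝ) ^ (-(1/2 + 1/p - 1/q - ε)) * cylLp q f := by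
  have hpq : 1/p < 1/q := one_div_lt_one_div_of_lt (by linarith) hqp
  obtain ⟨C₀, hC₀, h₀⟩ := exists_cylLp_le_of_decayKernel (γ := 1 + 1/p - 1/q - ε + ε/2) hq1 hqp
    hα hβ hscal (by linarith) (by linarith)
  obtain ⟨C₁, hC₁, h₁⟩ := exists_abs_cosKernel_half_le (θ := 1 + 1/p - 1/q - ε) hε
    (by linarith) (by linarith) (by linarith)
  obtain ⟨C₂, hC₂, h₂⟩ := exists_abs_cosKernel_three_half_le (θ := 1/2 + 1/p - 1/q - ε) hε
    (by linarith) (by linarith) (by linarith)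
  rw [show 1/2 + (1/2 + 1/p - 1/q - ε) + ε/2 = 1 + 1/p - 1/q - ε + ε/2 by ring] at h₂
  refine ⟨C₀ * (3 * (C₁ + C₂)) + 1, by positivity, fun m hm f g hf hg => ?_⟩
  have hm1 : (1:ℝ) ≤ m := by exact_mod_cast (by omega : 1 ≤ m)
  set A := (C₁ + C₂) * (m:ℝ) ^ (-(1/2 + 1/p - 1/q - ε)) with hA
  have hA0 : 0 ≤ A := by positivity
  have hmm : (m:ℝ) ^ (-(1 + 1/p - 1/q - ε)) ≤ (m:ℝ) ^ (-(1/2 + 1/p - 1/q - ε)) :=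
    rpow_le_rpow_of_exponent_le hm1 (by linarith)
  have hK : ∀ s, 0 < s → |cosKernel m (1/2) s| ≤
      A * decayKernel (1 + 1/p - 1/q - ε + ε/2) s := fun s hs => by
    refine (h₁ m hm s hs).trans (mul_le_mul_of_nonneg_right ?_ (decayKernel_nonneg _ hs.le))
    exact mul_le_mul (by linarith) hmm (by positivity) (by positivity)
  have hK' : ∀ s, 0 < s → (√s + s) * |cosKernel m (3/2) s| ≤
      A * decayKernel (1 + 1/p - 1/q - ε + ε/2) s := fun s hs => by
    refine (h₂ m hm s hs).trans (mul_le_mul_of_nonneg_right ?_ (decayKernel_nonneg _ hs.le))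
    exact mul_le_mul_of_nonneg_right (by linarith) (by positivity)
  have h := h₀ f (fun r z => r ^ α * Lminv m g r z) (3 * A) hf (by positivity) fun r hr z =>
    ofReal_abs_rpow_mul_Lminv_le hr z α <| by
      rcases hg with ⟨e, b, he, heb, hg⟩ | hg
      · exact ofReal_abs_integral_radial_le hm hA0 hK hK' hr z hf he heb (hg r hr)
      · exact ofReal_abs_integral_axial_le hA0 hK' hr z hf (hg r hr)
  have hm0 : 0 ≤ (m:ℝ) ^ (-(1/2 + 1/p - 1/q - ε)) * cylLp q f :=
    mul_nonneg (by positivity) (cylLp_nonneg q f)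
  rw [hA] at h
  linarith

end Helpers

/-- Proposition 2.5 (lemLm): weighted `L^p → L^q` bounds for `L_m^{-1}`. -/
theorem Lminv_weighted_bounds (p q α β : ℝ)
    (hq1 : 1 < q) (hqp : q < p)
    (hαβ : 0 < α + β) (hα : -3 ≤ α + 1/p) (hβ : -2 ≤ β - 1/q)
    (hscal : 1/q = 1/p + (α + β)/3) :
    ∃ ε₀ : ℝ, 0 < ε₀ ∧ ∀ ε : ℝ, 0 < ε → ε < ε₀ →
      ∃ C : ℝ, 0 < C ∧ ∀ m : ℕ, 3 ≤ m → ∀ f : ℝ → ℝ → ℝ, TestFun f →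
        (cylLp p (fun r z => r ^ α * Lminv m (fun r' z' => r' ^ (β - 2) * f r' z') r z)
            ≤ C * (m : ℝ) ^ (-(1 + 1/p - 1/q - ε)) * cylLp q f) ∧
        (0 < 1/2 + 1/p - 1/q →
          (cylLp p (fun r z => r ^ α *
              Lminv m (fun r' z' => (1/r') * deriv (fun s => s ^ β * f s z') r') r z)
              ≤ C * (m : ℝ) ^ (-(1/2 + 1/p - 1/q - ε)) * cylLp q f) ∧
          (cylLp p (fun r z => r ^ α *
              Lminv m (fun r' z' => (1/r') * deriv (fun s => r' ^ β * f r' s) z') r z)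
              ≤ C * (m : ℝ) ^ (-(1/2 + 1/p - 1/q - ε)) * cylLp q f) ∧
          (cylLp p (fun r z => r ^ α *
              Lminv m (fun r' z' => deriv (fun s => s ^ (β - 1) * f s z') r') r z)
              ≤ C * (m : ℝ) ^ (-(1/2 + 1/p - 1/q - ε)) * cylLp q f) ∧
          (cylLp p (fun r z => r ^ α *
              Lminv m (fun r' z' => deriv (fun s => r' ^ (β - 1) * f r' s) z') r z)
              ≤ C * (m : ℝ) ^ (-(1/2 + 1/p - 1/q - ε)) * cylLp q f)) := by
  have hq : 1/q < 1 := by rw [div_lt_one (by linarith)]; exact hq1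
  have hp : 0 < 1/p := one_div_pos.2 (by linarith)
  by_cases hc : 0 < 1/2 + 1/p - 1/q
  · refine ⟨1/2 + 1/p - 1/q, hc, fun ε hε hε1 => ?_⟩
    obtain ⟨C₁, hC₁, h₁⟩ := exists_cylLp_Lminv_le hq1 hqp hα hβ hscal hε (by linarith)
    obtain ⟨C₂, hC₂, h₂⟩ := exists_cylLp_Lminv_deriv_le hq1 hqp hα hβ hscal hε hε1
    refine ⟨C₁ + C₂, by positivity, fun m hm f hf => ⟨?_, fun _ => ?_⟩⟩
    · refine (h₁ m hm f hf).trans ?_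
      have := cylLp_nonneg q f
      gcongr
      linarith
    · have hle : C₂ * (m : ℝ) ^ (-(1/2 + 1/p - 1/q - ε)) * cylLp q f ≤
          (C₁ + C₂) * (m : ℝ) ^ (-(1/2 + 1/p - 1/q - ε)) * cylLp q f := by
        have := cylLp_nonneg q f
        gcongr
        linarith
      refine ⟨(h₂ m hm f _ hf (Or.inl ⟨-(1/2), β, by norm_num, by ring, ?_⟩)).trans hle,
        (h₂ m hm f _ hf (Or.inr ?_)).trans hle,
        (h₂ m hm f _ hf (Or.inl ⟨1/2, β - 1, by norm_num, by ring, ?_⟩)).trans hle,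
        (h₂ m hm f _ hf (Or.inr ?_)).trans hle⟩
      · intro r hr r' hr' z'
        rw [(hasDerivAt_rpow_mul_radial hf β hr' z').deriv, sqrt_div_eq_rpow hr hr',
          show (-(1/2) : ℝ) = 1/2 - 1 by norm_num, rpow_sub_one hr'.ne' (1/2)]
        ring
      · intro r hr r' hr' z'
        rw [((hf.hasDerivAt_axial r' z').const_mul (r' ^ β)).deriv, sqrt_div_eq_rpow hr hr',
          show β - 1/2 = β - 1 + 1/2 by ring, rpow_add hr', rpow_sub_one hr'.ne' β]
        ring
      · intro r hr r' hr' z'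
        rw [(hasDerivAt_rpow_mul_radial hf (β - 1) hr' z').deriv, sqrt_div_eq_rpow hr hr']
        ring
      · intro r hr r' hr' z'
        rw [((hf.hasDerivAt_axial r' z').const_mul (r' ^ (β - 1))).deriv,
          sqrt_div_eq_rpow hr hr', show β - 1/2 = β - 1 + 1/2 by ring, rpow_add hr']
        ring
  · refine ⟨1 + 1/p - 1/q, by linarith, fun ε hε hε1 => ?_⟩
    obtain ⟨C, hC, h⟩ := exists_cylLp_Lminv_le hq1 hqp hα hβ hscal hε hε1
    exact ⟨C, hC, fun m hm f hf => ⟨h m hm f hf, fun h0 => absurd h0 hc⟩⟩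

end
end
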